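/- arXiv:1906.08471 — 4 statements merged into one kernel-verified Lean document; each statement's English description precedes it below -/
import Mathlib

section
/- Assume in addition that ξ(1) = 1, let t > 0 and set a := t ξ'(1). Let ψ be a real-valued function on the set of Borel probability measures on ℝ_+ with finite first moment, satisfying | ψ(μ) − ψ(ν) | ≤ ∫_0^∞ | μ([0,r]) − ν([0,r]) | dr for all such μ, ν. Then for every Borel probability measure μ on ℝ_+ with ∫ ξ*(s/t) dμ(s) < ∞, writing μ̃ for the pushforward of μ under s ↦ min(s, a), one has ψ(μ) − t ∫ ξ*(s/t) dμ(s) ≤ ψ(μ̃) − t ∫ ξ*(s/t) dμ̃(s). -/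
open MeasureTheory

/-- The mixed `p`-spin correlation function `ξ(r) = ∑_{p=2}^n β_p r^p`. -/
noncomputable def xi (n : ℕ) (β : ℕ → ℝ) (r : ℝ) : ℝ :=
  ∑ p ∈ Finset.Icc 2 n, β p * r ^ p

/-- The convex dual `ξ*(s) = sup_{r ≥ 0} (r s - ξ(r))`. -/
noncomputable def xiStar (n : ℕ) (β : ℕ → ℝ) (s : ℝ) : ℝ :=
  sSup ((fun r => r * s - xi n β r) '' Set.Ici 0)

/-- Bernoulli's inequality, summed: `ξ` lies above its tangent line at `1`. -/
theorem xi_tangent_le (n : ℕ) (β : ℕ → ℝ) (hβ : ∀ p, 0 ≤ β p) {r : ℝ} (hr : 0 ≤ r) :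
    xi n β 1 + (∑ p ∈ Finset.Icc 2 n, β p * p) * (r - 1) ≤ xi n β r := by
  unfold xi
  rw [Finset.sum_mul, ← Finset.sum_add_distrib]
  refine Finset.sum_le_sum fun p _ => ?_
  have h := one_add_mul_le_pow (show (-2 : ℝ) ≤ r - 1 by linarith) p
  rw [add_sub_cancel] at h
  calc β p * 1 ^ p + β p * p * (r - 1) = β p * (1 + p * (r - 1)) := by rw [one_pow]; ring
    _ ≤ β p * r ^ p := mul_le_mul_of_nonneg_left h (hβ p)

theorem deriv_xi_one (n : ℕ) (β : ℕ → ℝ) :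
    deriv (xi n β) 1 = ∑ p ∈ Finset.Icc 2 n, β p * p := by
  have h : HasDerivAt (xi n β) (∑ p ∈ Finset.Icc 2 n, β p * (p * 1 ^ (p - 1))) 1 :=
    HasDerivAt.fun_sum fun p _ => (hasDerivAt_pow p (1 : ℝ)).const_mul (β p)
  simpa using h.deriv

theorem bddAbove_xiStar (n : ℕ) (β : ℕ → ℝ) (hβ : ∀ p, 0 ≤ β p)
    (hβne : ∃ p ∈ Finset.Icc 2 n, β p ≠ 0) (s : ℝ) :
    BddAbove ((fun r => r * s - xi n β r) '' Set.Ici 0) := by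
  obtain ⟨p, hp, hne⟩ := hβne
  have hb : 0 < β p := lt_of_le_of_ne (hβ p) hne.symm
  refine ⟨|s| + s ^ 2 / (4 * β p), ?_⟩
  rintro _ ⟨r, hr, rfl⟩
  have hr : 0 ≤ r := hr
  have hxi : β p * r ^ p ≤ xi n β r :=
    Finset.single_le_sum (f := fun p => β p * r ^ p)
      (fun q _ => mul_nonneg (hβ q) (pow_nonneg hr q)) hp
  have hq : 0 ≤ s ^ 2 / (4 * β p) := by positivity
  change r * s - xi n β r ≤ _
  rcases le_total r 1 with h1 | h1
  · have : 0 ≤ β p * r ^ p := by positivity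
    have : r * s ≤ |s| := by
      nlinarith [le_abs_self s, abs_nonneg s, mul_le_mul_of_nonneg_left (le_abs_self s) hr]
    linarith
  · have hpow : r ^ 2 ≤ r ^ p := pow_le_pow_right₀ h1 (Finset.mem_Icc.mp hp).1
    have := mul_le_mul_of_nonneg_left hpow hb.le
    have hsq : r * s - β p * r ^ 2 ≤ s ^ 2 / (4 * β p) := by
      rw [le_div_iff₀ (by positivity)]
      nlinarith [sq_nonneg (s - 2 * β p * r)]
    linarith [abs_nonneg s]

theorem sub_xi_le_xiStar (n : ℕ) (β : ℕ → ℝ) (hβ : ∀ p, 0 ≤ β p)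
    (hβne : ∃ p ∈ Finset.Icc 2 n, β p ≠ 0) {r : ℝ} (hr : 0 ≤ r) (s : ℝ) :
    r * s - xi n β r ≤ xiStar n β s :=
  le_csSup (bddAbove_xiStar n β hβ hβne s) ⟨r, hr, rfl⟩

theorem xiStar_nonneg (n : ℕ) (β : ℕ → ℝ) (hβ : ∀ p, 0 ≤ β p)
    (hβne : ∃ p ∈ Finset.Icc 2 n, β p ≠ 0) (s : ℝ) : 0 ≤ xiStar n β s := by
  refine le_trans (le_of_eq ?_) (sub_xi_le_xiStar n β hβ hβne le_rfl s)
  have : xi n β 0 = 0 := Finset.sum_eq_zero fun p hp => by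
    have := (Finset.mem_Icc.mp hp).1
    rw [zero_pow (by lia), mul_zero]
  rw [this, zero_mul, sub_zero]

theorem xiStar_mono (n : ℕ) (β : ℕ → ℝ) (hβ : ∀ p, 0 ≤ β p)
    (hβne : ∃ p ∈ Finset.Icc 2 n, β p ≠ 0) : Monotone (xiStar n β) := by
  intro s u hsu
  refine csSup_le (Set.nonempty_Ici.image _) ?_
  rintro _ ⟨r, hr, rfl⟩
  have h := sub_xi_le_xiStar n β hβ hβne hr u
  have := mul_le_mul_of_nonneg_left hsu (show (0 : ℝ) ≤ r from hr)
  change r * s - xi n β r ≤ _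
  linarith

/-- The supremum defining `ξ*(ξ'(1))` is attained at `1`. -/
theorem xiStar_deriv_le (n : ℕ) (β : ℕ → ℝ) (hβ : ∀ p, 0 ≤ β p) :
    xiStar n β (deriv (xi n β) 1) ≤ deriv (xi n β) 1 - xi n β 1 := by
  refine csSup_le (Set.nonempty_Ici.image _) ?_
  rintro _ ⟨r, hr, rfl⟩
  have h := xi_tangent_le n β hβ (show (0 : ℝ) ≤ r from hr)
  rw [← deriv_xi_one] at h
  change r * deriv (xi n β) 1 - xi n β r ≤ _
  linarith

/-- Beyond `t ξ'(1)` the function `s ↦ t ξ*(s/t)` grows at least at unit rate. -/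
theorem sub_min_le_xiStar_sub (n : ℕ) (β : ℕ → ℝ) (hβ : ∀ p, 0 ≤ β p)
    (hβne : ∃ p ∈ Finset.Icc 2 n, β p ≠ 0) {t : ℝ} (ht : 0 < t) (s : ℝ) :
    s - min s (t * deriv (xi n β) 1) ≤
      t * (xiStar n β (s / t) - xiStar n β (min s (t * deriv (xi n β) 1) / t)) := by
  rcases le_total s (t * deriv (xi n β) 1) with h | h
  · simp [min_eq_left h]
  · rw [min_eq_right h, mul_div_cancel_left₀ _ ht.ne']
    have h1 := xiStar_deriv_le n β hβ
    have h2 := sub_xi_le_xiStar n β hβ hβne zero_le_one (s / t)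
    calc s - t * deriv (xi n β) 1 = t * (s / t - deriv (xi n β) 1) := by
          field_simp
      _ ≤ _ := mul_le_mul_of_nonneg_left (by linarith) ht.le

/-- The `L¹` distance between the distribution functions of `μ` and of its pushforward under
a map `f` with `0 ≤ f s ≤ s` for `s ≥ 0` is at most the mean displacement. -/
theorem lintegral_cdf_sub_map_le (μ : Measure ℝ) [IsProbabilityMeasure μ]
    (hμ : ∀ᵐ s ∂μ, 0 ≤ s) {f : ℝ → ℝ} (hf : Measurable f)
    (hf0 : ∀ s, 0 ≤ s → 0 ≤ f s) (hfle : ∀ s, f s ≤ s) :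
    ∫⁻ r in Set.Ici (0 : ℝ),
        ENNReal.ofReal |(μ (Set.Icc 0 r)).toReal - ((μ.map f) (Set.Icc 0 r)).toReal| ≤
      ∫⁻ s, ENNReal.ofReal (s - f s) ∂μ := by
  set S : Set (ℝ × ℝ) := {q | f q.2 ≤ q.1 ∧ q.1 < q.2}
  have hS : MeasurableSet S :=
    (measurableSet_le (hf.comp measurable_snd) measurable_fst).inter
      (measurableSet_lt measurable_fst measurable_snd)
  have hpt : ∀ r : ℝ,
      ENNReal.ofReal |(μ (Set.Icc 0 r)).toReal - ((μ.map f) (Set.Icc 0 r)).toReal| ≤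
        μ (Prod.mk r ⁻¹' S) := by
    intro r
    rw [Measure.map_apply hf measurableSet_Icc]
    have hsub : μ (Set.Icc 0 r) ≤ μ (f ⁻¹' Set.Icc 0 r) :=
      measure_mono fun s hs => ⟨hf0 s hs.1, (hfle s).trans hs.2⟩
    have hadd : μ (f ⁻¹' Set.Icc 0 r) ≤ μ (Set.Icc 0 r) + μ (Prod.mk r ⁻¹' S) := by
      refine le_trans (measure_mono_ae ?_) (measure_union_le _ _)
      filter_upwards [hμ] with s hs hfs
      rcases le_or_gt s r with h | h
      · exact Or.inl ⟨hs, h⟩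
      · exact Or.inr ⟨hfs.2, h⟩
    have hsub' := ENNReal.toReal_mono (measure_ne_top μ _) hsub
    have hadd' := ENNReal.toReal_mono (by finiteness) hadd
    rw [ENNReal.toReal_add (measure_ne_top μ _) (measure_ne_top μ _)] at hadd'
    rw [abs_sub_comm, abs_of_nonneg (by linarith)]
    refine ENNReal.ofReal_le_of_le_toReal ?_
    linarith
  calc _ ≤ ∫⁻ r in Set.Ici (0 : ℝ), μ (Prod.mk r ⁻¹' S) := lintegral_mono hpt
    _ ≤ ∫⁻ r, μ (Prod.mk r ⁻¹' S) := setLIntegral_le_lintegral _ _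
    _ = (volume.prod μ) S := (Measure.prod_apply hS).symm
    _ = ∫⁻ s, volume ((fun r => (r, s)) ⁻¹' S) ∂μ := Measure.prod_apply_symm hS
    _ = ∫⁻ s, ENNReal.ofReal (s - f s) ∂μ :=
        lintegral_congr fun s => (Real.volume_Ico (a := f s) (b := s))

/-- Localization of the Hopf-Lax supremum: if `ψ` is `1`-Lipschitz for the `L¹` distance
between cumulative distribution functions (on probability measures on `ℝ₊` with finite
first moment), then for every probability measure `μ` on `ℝ₊` with
`∫ ξ*(s/t) dμ(s) < ∞`, truncating `μ` at level `a = t ξ'(1)` can only increase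
`ψ(μ) - t ∫ ξ*(s/t) dμ(s)`. -/
theorem hopf_lax_localization (n : ℕ) (hn : 2 ≤ n) (β : ℕ → ℝ) (hβ : ∀ p, 0 ≤ β p)
    (hβne : ∃ p ∈ Finset.Icc 2 n, β p ≠ 0) (hnorm : xi n β 1 = 1)
    (t : ℝ) (ht : 0 < t)
    (ψ : Measure ℝ → ℝ)
    (hψ : ∀ μ ν : Measure ℝ, IsProbabilityMeasure μ → IsProbabilityMeasure ν →
      μ (Set.Ici 0) = 1 → ν (Set.Ici 0) = 1 →
      Integrable (fun s => s) μ → Integrable (fun s => s) ν →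
      ENNReal.ofReal |ψ μ - ψ ν| ≤
        ∫⁻ r in Set.Ici (0:ℝ),
          ENNReal.ofReal |(μ (Set.Icc 0 r)).toReal - (ν (Set.Icc 0 r)).toReal|)
    (μ : Measure ℝ) (hμP : IsProbabilityMeasure μ) (hμ0 : μ (Set.Ici 0) = 1)
    (hint : Integrable (fun s => xiStar n β (s / t)) μ) :
    ψ μ - t * ∫ s, xiStar n β (s / t) ∂μ
      ≤ ψ (μ.map fun s => min s (t * deriv (xi n β) 1))
        - t * ∫ s, xiStar n β (s / t) ∂(μ.map fun s => min s (t * deriv (xi n β) 1)) := by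
  set a := t * deriv (xi n β) 1
  have ha : 0 ≤ a := mul_nonneg ht.le <| by
    rw [deriv_xi_one]
    exact Finset.sum_nonneg fun p _ => mul_nonneg (hβ p) (Nat.cast_nonneg p)
  have hpos : ∀ᵐ s ∂μ, 0 ≤ s := (prob_compl_eq_zero_iff measurableSet_Ici).mpr hμ0
  have hf : Measurable fun s : ℝ => min s a := measurable_id.min measurable_const
  have hstar : Measurable fun s => xiStar n β (s / t) :=
    (xiStar_mono n β hβ hβne).measurable.comp (measurable_id.div_const t)
  have hid : Integrable (fun s => s) μ := by
    refine ((hint.add (integrable_const 1)).const_mul t).mono'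
      measurable_id.aestronglyMeasurable ?_
    filter_upwards [hpos] with s hs
    have h := sub_xi_le_xiStar n β hβ hβne zero_le_one (s / t)
    rw [hnorm, one_mul] at h
    rw [Real.norm_of_nonneg hs]
    calc s = t * (s / t) := by field_simp
      _ ≤ _ := mul_le_mul_of_nonneg_left
        (show s / t ≤ xiStar n β (s / t) + 1 by linarith) ht.le
  have hidf : Integrable (fun s => min s a) μ := hid.inf (integrable_const a)
  have hintf : Integrable (fun s => xiStar n β (min s a / t)) μ := by
    refine hint.mono' (hstar.comp hf).aestronglyMeasurable (Filter.Eventually.of_forall fun s => ?_)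
    rw [Real.norm_of_nonneg (xiStar_nonneg n β hβ hβne _)]
    exact xiStar_mono n β hβ hβne (by gcongr; exact min_le_left s a)
  have hmapP : IsProbabilityMeasure (μ.map fun s => min s a) :=
    Measure.isProbabilityMeasure_map hf.aemeasurable
  have hmap0 : (μ.map fun s => min s a) (Set.Ici 0) = 1 := by
    rw [Measure.map_apply hf measurableSet_Ici, ← hμ0]
    congr 1
    ext s
    simp [ha]
  have hmapid : Integrable (fun s => s) (μ.map fun s => min s a) :=
    (integrable_map_measure measurable_id.aestronglyMeasurable hf.aemeasurable).mpr hidf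
  have hnn : ∀ s, 0 ≤ s - min s a := fun s => sub_nonneg.mpr (min_le_left s a)
  have hdiff : Integrable (fun s => s - min s a) μ := hid.sub hidf
  have hlip := (hψ μ _ hμP hmapP hμ0 hmap0 hid hmapid).trans
    (lintegral_cdf_sub_map_le μ hpos hf (fun s hs => le_min hs ha) fun s => min_le_left s a)
  rw [← ofReal_integral_eq_lintegral_ofReal hdiff (Filter.Eventually.of_forall hnn),
    ENNReal.ofReal_le_ofReal_iff (integral_nonneg hnn)] at hlip
  have hmono : ∫ s, (s - min s a) ∂μ ≤
      ∫ s, t * (xiStar n β (s / t) - xiStar n β (min s a / t)) ∂μ :=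
    integral_mono hdiff ((hint.sub hintf).const_mul t)
      (sub_min_le_xiStar_sub n β hβ hβne ht)
  rw [integral_const_mul, integral_sub hint hintf, mul_sub] at hmono
  rw [integral_map hf.aemeasurable hstar.aestronglyMeasurable]
  linarith [le_abs_self (ψ μ - ψ (μ.map fun s => min s a))]
end

section
/- Let μ be a Borel probability measure on ℝ_+, let q ≥ 0 satisfy μ([0,q]) = 1, let q' ≥ q, and let b > 2∫_0^{q'} μ([0,r]) dr. Define Φ(Q, B) := ∫_0^Q ( B − 2∫_s^Q μ([0,r]) dr )^{-1} ds + (B − 1 − log B)/2 − Q. Then Φ(q', b) = Φ(q, b − 2(q' − q)). -/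
open MeasureTheory

/-- The functional `Φ(Q,B) = ∫_0^Q (B - 2∫_s^Q μ([0,r]) dr)⁻¹ ds + (B - 1 - log B)/2 - Q`. -/
noncomputable def Phi (μ : Measure ℝ) (Q B : ℝ) : ℝ :=
  (∫ s in (0:ℝ)..Q, (B - 2 * ∫ r in s..Q, (μ (Set.Icc 0 r)).toReal)⁻¹)
    + (B - 1 - Real.log B) / 2 - Q

lemma monotone_measure_Icc_toReal (μ : Measure ℝ) [IsFiniteMeasure μ] :
    Monotone fun r : ℝ => (μ (Set.Icc 0 r)).toReal := fun _ _ h =>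
  ENNReal.toReal_mono (measure_ne_top _ _) (measure_mono (Set.Icc_subset_Icc_right h))

lemma measure_Icc_toReal_eq_one (μ : Measure ℝ) [IsProbabilityMeasure μ] {q r : ℝ}
    (hμq : μ (Set.Icc 0 q) = 1) (hr : q ≤ r) : (μ (Set.Icc 0 r)).toReal = 1 := by
  have h : μ (Set.Icc 0 r) = 1 :=
    le_antisymm prob_le_one (hμq ▸ measure_mono (Set.Icc_subset_Icc_right hr))
  simp [h]

lemma integral_inv_sub_two_mul {a c b : ℝ} (hac : a ≤ c) (hb : 2 * (c - a) < b) :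
    ∫ s in a..c, (b - 2 * (c - s))⁻¹ = (Real.log b - Real.log (b - 2 * (c - a))) / 2 := by
  have hpos : ∀ s ∈ Set.uIcc a c, b - 2 * (c - s) ≠ 0 := by
    intro s hs
    rw [Set.uIcc_of_le hac] at hs
    linarith [hs.1]
  have hderiv : ∀ s ∈ Set.uIcc a c,
      HasDerivAt (fun s => Real.log (b - 2 * (c - s)) / 2) (b - 2 * (c - s))⁻¹ s := by
    intro s hs
    have h : HasDerivAt (fun s : ℝ => b - 2 * (c - s)) 2 s := by
      simpa using (((hasDerivAt_id s).const_sub c).const_mul 2).const_sub b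
    exact ((h.log (hpos s hs)).div_const 2).congr_deriv (by field_simp)
  have hcont : ContinuousOn (fun s : ℝ => (b - 2 * (c - s))⁻¹) (Set.uIcc a c) :=
    ContinuousOn.inv₀ (by fun_prop) hpos
  rw [intervalIntegral.integral_eq_sub_of_hasDerivAt hderiv hcont.intervalIntegrable]
  simp only [sub_self, mul_zero, sub_zero]
  ring

/-- The displayed identity in the proof of Proposition 3.1(2):
`Φ(q', b) = Φ(q, b - 2(q' - q))` whenever `μ([0,q]) = 1`, `q' ≥ q` and
`b > 2 ∫_0^{q'} μ([0,r]) dr`. -/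
theorem Phi_shift (μ : Measure ℝ) [IsProbabilityMeasure μ]
    (q : ℝ) (hq : 0 ≤ q) (hμq : μ (Set.Icc 0 q) = 1)
    (q' : ℝ) (hq' : q ≤ q')
    (b : ℝ) (hb : 2 * ∫ r in (0:ℝ)..q', (μ (Set.Icc 0 r)).toReal < b) :
    Phi μ q' b = Phi μ q (b - 2 * (q' - q)) := by
  unfold Phi
  set F : ℝ → ℝ := fun r => (μ (Set.Icc 0 r)).toReal
  have hF : ∀ x y, IntervalIntegrable F volume x y := fun x y =>
    (monotone_measure_Icc_toReal μ).intervalIntegrable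
  have hF0 : ∀ r, 0 ≤ F r := fun r => ENNReal.toReal_nonneg
  have htail : ∀ s, q ≤ s → s ≤ q' → ∫ r in s..q', F r = q' - s := by
    intro s hs hs'
    rw [intervalIntegral.integral_congr (g := fun _ => (1 : ℝ))]
    · simp
    · intro r hr
      rw [Set.uIcc_of_le hs'] at hr
      exact measure_Icc_toReal_eq_one μ hμq (hs.trans hr.1)
  have hsplit : ∀ s, ∫ r in s..q', F r = (∫ r in s..q, F r) + (q' - q) := fun s => by
    rw [← htail q le_rfl hq', intervalIntegral.integral_add_adjacent_intervals (hF _ _) (hF _ _)]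
  have hne : ∀ s ∈ Set.Icc 0 q', b - 2 * ∫ r in s..q', F r ≠ 0 := by
    intro s hs
    have h := intervalIntegral.integral_add_adjacent_intervals (hF 0 s) (hF s q')
    have h0 : 0 ≤ ∫ r in (0:ℝ)..s, F r :=
      intervalIntegral.integral_nonneg hs.1 fun r _ => hF0 r
    apply ne_of_gt
    linarith
  have hcont : ContinuousOn (fun s => (b - 2 * ∫ r in s..q', F r)⁻¹) (Set.Icc 0 q') := by
    refine ContinuousOn.inv₀ (Continuous.continuousOn ?_) hne
    simp_rw [intervalIntegral.integral_symm q']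
    have := intervalIntegral.continuous_primitive hF q'
    fun_prop
  have hb' : 2 * (q' - q) < b := by
    have h0 : 0 ≤ ∫ r in (0:ℝ)..q, F r := intervalIntegral.integral_nonneg hq fun r _ => hF0 r
    have := hsplit 0
    linarith
  have hhead : ∫ s in (0:ℝ)..q, (b - 2 * ∫ r in s..q', F r)⁻¹
      = ∫ s in (0:ℝ)..q, (b - 2 * (q' - q) - 2 * ∫ r in s..q, F r)⁻¹ := by
    congr 1 with s
    rw [hsplit s]
    ring
  have hlast : ∫ s in q..q', (b - 2 * ∫ r in s..q', F r)⁻¹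
      = ∫ s in q..q', (b - 2 * (q' - s))⁻¹ := by
    refine intervalIntegral.integral_congr fun s hs => ?_
    rw [Set.uIcc_of_le hq'] at hs
    simp only [htail s hs.1 hs.2]
  rw [← intervalIntegral.integral_add_adjacent_intervals
      ((hcont.mono (Set.Icc_subset_Icc_right hq')).intervalIntegrable_of_Icc hq)
      ((hcont.mono (Set.Icc_subset_Icc_left hq)).intervalIntegrable_of_Icc hq'),
    hhead, hlast, integral_inv_sub_two_mul hq' hb']
  ring
end

section
/- For every t > 0 and h > 0, the partial derivatives ∂_t F̄°(t,h) and ∂_h F̄°(t,h) exist and satisfy ∂_t F̄°(t,h) − ξ( ∂_h F̄°(t,h) ) = E⟨ ξ( (σ·σ')/N ) ⟩ − ξ( E⟨ (σ·σ')/N ⟩ ). -/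
open MeasureTheory ProbabilityTheory

/-- Index set for the disorder variables `(J_{p,i})`. -/
abbrev SpinIdx (n N : ℕ) := (p : {p : ℕ // p ∈ Finset.Icc 2 n}) × (Fin (p : ℕ) → Fin N)

/-- The law of the full Gaussian randomness `(J, z)`: independent standard Gaussians. -/
noncomputable def disorderZ (n N : ℕ) : Measure ((SpinIdx n N → ℝ) × (Fin N → ℝ)) :=
  (Measure.pi fun _ : SpinIdx n N => gaussianReal 0 1).prod
    (Measure.pi fun _ : Fin N => gaussianReal 0 1)

/-- The mixed `p`-spin Hamiltonian `H_N(σ)`. -/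
noncomputable def hamiltonian (n : ℕ) (β : ℕ → ℝ) (N : ℕ) (σ : Fin N → ℝ)
    (J : SpinIdx n N → ℝ) : ℝ :=
  ∑ p : {p : ℕ // p ∈ Finset.Icc 2 n},
    Real.sqrt (β p) * (N : ℝ) ^ (((1 : ℝ) - (p : ℕ)) / 2) *
      ∑ i : Fin (p : ℕ) → Fin N, J ⟨p, i⟩ * ∏ j, σ (i j)

/-- The normalized enriched Hamiltonian
`H_{t,h}(σ) = √(2t) H_N(σ) - N t ξ(|σ|²/N) + √(2h) z·σ - h|σ|²`. -/
noncomputable def enrichedH (n : ℕ) (β : ℕ → ℝ) (N : ℕ) (t h : ℝ) (σ : Fin N → ℝ)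
    (ω : (SpinIdx n N → ℝ) × (Fin N → ℝ)) : ℝ :=
  Real.sqrt (2 * t) * hamiltonian n β N σ ω.1 - N * t * xi n β ((∑ i, σ i ^ 2) / N)
    + Real.sqrt (2 * h) * (∑ i, ω.2 i * σ i) - h * ∑ i, σ i ^ 2

/-- The enriched free energy `F̄°(t,h)`. -/
noncomputable def freeEnergy (n : ℕ) (β : ℕ → ℝ) (N : ℕ) (P : Measure (Fin N → ℝ))
    (t h : ℝ) : ℝ :=
  -(1 / (N : ℝ)) *
    ∫ ω, Real.log (∫ σ, Real.exp (enrichedH n β N t h σ ω) ∂P) ∂(disorderZ n N)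

/-- The averaged Gibbs bracket `E⟨ g(σ,σ') ⟩` for two replicas. -/
noncomputable def gibbsBracket (n : ℕ) (β : ℕ → ℝ) (N : ℕ) (P : Measure (Fin N → ℝ))
    (t h : ℝ) (g : (Fin N → ℝ) → (Fin N → ℝ) → ℝ) : ℝ :=
  ∫ ω,
    (∫ σ, ∫ σ', g σ σ' *
        Real.exp (enrichedH n β N t h σ ω + enrichedH n β N t h σ' ω) ∂P ∂P)
      / (∫ σ, Real.exp (enrichedH n β N t h σ ω) ∂P) ^ 2 ∂(disorderZ n N)

/-- Stein's identity for the standard Gaussian measure on `ℝ`. -/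
lemma integral_id_mul_gaussianReal {f f' : ℝ → ℝ} (hf : ∀ x, HasDerivAt f (f' x) x)
    (hfi : Integrable f (gaussianReal 0 1)) (hfi' : Integrable f' (gaussianReal 0 1))
    (hxf : Integrable (fun x => x * f x) (gaussianReal 0 1)) :
    ∫ x, x * f x ∂(gaussianReal 0 1) = ∫ x, f' x ∂(gaussianReal 0 1) := by
  have hint : ∀ g : ℝ → ℝ, Integrable g (gaussianReal 0 1) →
      Integrable (fun x => gaussianPDFReal 0 1 x * g x) := by
    intro g hg
    rw [gaussianReal_of_var_ne_zero _ one_ne_zero,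
      integrable_withDensity_iff_integrable_smul₀' (measurable_gaussianPDF 0 1).aemeasurable
        (Filter.Eventually.of_forall fun _ => gaussianPDF_lt_top)] at hg
    simpa [toReal_gaussianPDF] using hg
  have hpdf : ∀ x, HasDerivAt (gaussianPDFReal 0 1) (-(x * gaussianPDFReal 0 1 x)) x := by
    intro x
    have h1 : HasDerivAt (fun y : ℝ => -(y - 0) ^ 2 / (2 * ((1 : NNReal) : ℝ))) (-x) x := by
      have := ((((hasDerivAt_id x).sub_const 0).pow 2).neg).div_const (2 * ((1 : NNReal) : ℝ))
      refine this.congr_deriv ?_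
      simp
      ring
    have h2 := (h1.exp).const_mul (√(2 * Real.pi * ((1 : NNReal) : ℝ)))⁻¹
    refine h2.congr_deriv ?_
    simp only [gaussianPDFReal]
    ring
  have key := integral_mul_deriv_eq_deriv_mul_of_integrable (u := f) (v := gaussianPDFReal 0 1)
    (u' := f') (v' := fun x => -(x * gaussianPDFReal 0 1 x)) (fun x _ => hf x)
    (fun x _ => hpdf x)
    ((hint _ hxf).neg.congr (Filter.Eventually.of_forall fun x => by
      simp only [Pi.neg_apply, Pi.mul_apply]; ring))
    ((hint _ hfi').congr (Filter.Eventually.of_forall fun x => by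
      simp only [Pi.mul_apply]; ring))
    ((hint _ hfi).congr (Filter.Eventually.of_forall fun x => by
      simp only [Pi.mul_apply]; ring))
  rw [integral_gaussianReal_eq_integral_smul one_ne_zero,
    integral_gaussianReal_eq_integral_smul one_ne_zero]
  simp only [smul_eq_mul]
  calc ∫ x, gaussianPDFReal 0 1 x * (x * f x)
      = -∫ x, f x * -(x * gaussianPDFReal 0 1 x) := by
        rw [← integral_neg]
        congr 1 with x
        ring
    _ = ∫ x, gaussianPDFReal 0 1 x * f' x := by
        rw [key, neg_neg]
        congr 1 with x
        ring

/-- Resampling one coordinate preserves a product probability measure. -/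
lemma measurePreserving_update_pi {ι : Type*} [Fintype ι] [DecidableEq ι] {X : ι → Type*}
    [∀ i, MeasurableSpace (X i)] (μ : ∀ i, Measure (X i)) [∀ i, IsProbabilityMeasure (μ i)]
    (k : ι) :
    MeasurePreserving (fun q : (∀ i, X i) × X k => Function.update q.1 k q.2)
      ((Measure.pi μ).prod (μ k)) (Measure.pi μ) := by
  have hm : Measurable (fun q : (∀ i, X i) × X k => Function.update q.1 k q.2) := by
    refine measurable_pi_lambda _ fun i => ?_
    by_cases hi : i = k
    · subst hi
      simpa using measurable_snd
    · simp only [Function.update_of_ne hi]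
      exact (measurable_pi_apply i).comp measurable_fst
  refine ⟨hm, (Measure.pi_eq fun s hs => ?_).symm⟩
  rw [Measure.map_apply hm (MeasurableSet.univ_pi hs)]
  have hpre : (fun q : (∀ i, X i) × X k => Function.update q.1 k q.2) ⁻¹' Set.univ.pi s
      = (Set.univ.pi (Function.update s k Set.univ)) ×ˢ s k := by
    ext q
    simp only [Set.mem_preimage, Set.mem_pi, Set.mem_univ, true_imp_iff, Set.mem_prod]
    constructor
    · refine fun hq => ⟨fun i => ?_, by simpa using hq k⟩
      by_cases hi : i = k
      · subst hi
        simp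
      · simpa [Function.update_of_ne hi] using hq i
    · rintro ⟨h1, h2⟩ i
      by_cases hi : i = k
      · subst hi
        simpa using h2
      · simpa [Function.update_of_ne hi] using h1 i
  rw [hpre, Measure.prod_prod, Measure.pi_pi, ← Finset.prod_erase_mul _ _ (Finset.mem_univ k),
    ← Finset.prod_erase_mul (Finset.univ) (fun i => μ i (s i)) (Finset.mem_univ k)]
  simp only [Function.update_self, measure_univ, mul_one]
  congr 1
  refine Finset.prod_congr rfl fun i hi => ?_
  rw [Function.update_of_ne (Finset.ne_of_mem_erase hi)]

/-- Gaussian integration by parts in one coordinate, for bounded functions with bounded partial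
derivative. -/
lemma integral_apply_mul_pi_gaussianReal {ι : Type*} [Fintype ι] [DecidableEq ι] (k : ι)
    {G D : (ι → ℝ) → ℝ} (hG : Measurable G) (hD : Measurable D) {C : ℝ}
    (hGb : ∀ J, |G J| ≤ C) (hDb : ∀ J, |D J| ≤ C)
    (hd : ∀ J y, HasDerivAt (fun y => G (Function.update J k y)) (D (Function.update J k y)) y) :
    ∫ J, J k * G J ∂(Measure.pi fun _ : ι => gaussianReal 0 1)
      = ∫ J, D J ∂(Measure.pi fun _ : ι => gaussianReal 0 1) := by
  have hmp := measurePreserving_update_pi (fun _ : ι => gaussianReal 0 1) k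
  have hcoord : Integrable (fun J : ι → ℝ => J k) (Measure.pi fun _ : ι => gaussianReal 0 1) :=
    integrable_comp_eval (μ := fun _ : ι => gaussianReal 0 1) (i := k) (f := fun x : ℝ => x)
      ((memLp_id_gaussianReal 1).integrable (by simp))
  have hint1 : Integrable (fun J : ι → ℝ => J k * G J)
      (Measure.pi fun _ : ι => gaussianReal 0 1) :=
    hcoord.mul_bdd hG.aestronglyMeasurable (Filter.Eventually.of_forall hGb)
  have hint2 : Integrable D (Measure.pi fun _ : ι => gaussianReal 0 1) :=
    Integrable.of_bound hD.aestronglyMeasurable C (Filter.Eventually.of_forall hDb)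
  have resample : ∀ F : (ι → ℝ) → ℝ, Integrable F (Measure.pi fun _ : ι => gaussianReal 0 1) →
      ∫ J, F J ∂(Measure.pi fun _ : ι => gaussianReal 0 1)
        = ∫ J, ∫ y, F (Function.update J k y) ∂(gaussianReal 0 1)
            ∂(Measure.pi fun _ : ι => gaussianReal 0 1) := by
    intro F hF
    rw [← integral_prod (fun q : (ι → ℝ) × ℝ => F (Function.update q.1 k q.2))
      (hmp.integrable_comp_of_integrable hF)]
    conv_lhs => rw [← hmp.map_eq]
    exact integral_map hmp.measurable.aemeasurable (by rw [hmp.map_eq]; exact hF.1)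
  rw [resample _ hint1, resample _ hint2]
  congr 1 with J
  have hu : Measurable fun y : ℝ => Function.update J k y := measurable_update J
  simp only [Function.update_self]
  have hGi : Integrable (fun y => G (Function.update J k y)) (gaussianReal 0 1) :=
    Integrable.of_bound (hG.comp hu).aestronglyMeasurable C
      (Filter.Eventually.of_forall fun _ => hGb _)
  refine integral_id_mul_gaussianReal (fun y => hd J y) hGi ?_ ?_
  · exact Integrable.of_bound (hD.comp hu).aestronglyMeasurable C
      (Filter.Eventually.of_forall fun _ => hDb _)
  · exact ((memLp_id_gaussianReal 1).integrable (by simp)).mul_bdd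
      hGi.1 (Filter.Eventually.of_forall fun _ => hGb _)

section GibbsAverage

variable {S : Type*} [MeasurableSpace S]

/-- The average of `m` under the Gibbs measure proportional to `exp E` with respect to `P`. -/
noncomputable def gibbsAvg (P : Measure S) (E m : S → ℝ) : ℝ :=
  (∫ σ, m σ * Real.exp (E σ) ∂P) / ∫ σ, Real.exp (E σ) ∂P

variable {P : Measure S} [IsProbabilityMeasure P] {E m : S → ℝ} {A C : ℝ}

lemma integrable_mul_exp (hm : Measurable m) (hE : Measurable E)
    (hmb : ∀ᵐ σ ∂P, |m σ| ≤ A) (hEb : ∀ᵐ σ ∂P, |E σ| ≤ C) :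
    Integrable (fun σ => m σ * Real.exp (E σ)) P := by
  refine Integrable.of_bound (hm.mul hE.exp).aestronglyMeasurable (A * Real.exp C) ?_
  filter_upwards [hmb, hEb] with σ h1 h2
  rw [Real.norm_eq_abs, abs_mul, Real.abs_exp]
  exact mul_le_mul h1 (Real.exp_le_exp.2 (abs_le.1 h2).2) (Real.exp_pos _).le
    ((abs_nonneg _).trans h1)

lemma integrable_exp_of_ae_bounded (hE : Measurable E) (hEb : ∀ᵐ σ ∂P, |E σ| ≤ C) :
    Integrable (fun σ => Real.exp (E σ)) P := by
  simpa using integrable_mul_exp (P := P) (m := fun _ => 1) (A := 1) measurable_const hE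
    (by simp) hEb

lemma integral_exp_mem_Icc (hE : Measurable E) (hEb : ∀ᵐ σ ∂P, |E σ| ≤ C) :
    ∫ σ, Real.exp (E σ) ∂P ∈ Set.Icc (Real.exp (-C)) (Real.exp C) := by
  have hi := integrable_exp_of_ae_bounded hE hEb
  constructor
  · have := integral_mono_ae (μ := P) (integrable_const (Real.exp (-C))) hi
      (hEb.mono fun σ h => Real.exp_le_exp.2 (abs_le.1 h).1)
    simpa using this
  · have := integral_mono_ae (μ := P) hi (integrable_const (Real.exp C))
      (hEb.mono fun σ h => Real.exp_le_exp.2 (abs_le.1 h).2)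
    simpa using this

lemma integral_exp_pos_of_ae_bounded (hE : Measurable E) (hEb : ∀ᵐ σ ∂P, |E σ| ≤ C) :
    0 < ∫ σ, Real.exp (E σ) ∂P :=
  (Real.exp_pos _).trans_le (integral_exp_mem_Icc hE hEb).1

lemma abs_log_integral_exp_le (hE : Measurable E) (hEb : ∀ᵐ σ ∂P, |E σ| ≤ C) :
    |Real.log (∫ σ, Real.exp (E σ) ∂P)| ≤ C := by
  have hpos := integral_exp_pos_of_ae_bounded hE hEb
  obtain ⟨h1, h2⟩ := integral_exp_mem_Icc hE hEb
  exact abs_le.2 ⟨(Real.le_log_iff_exp_le hpos).2 h1, (Real.log_le_iff_le_exp hpos).2 h2⟩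

lemma abs_gibbsAvg_le (hE : Measurable E) (hmb : ∀ᵐ σ ∂P, |m σ| ≤ A)
    (hEb : ∀ᵐ σ ∂P, |E σ| ≤ C) : |gibbsAvg P E m| ≤ A := by
  have hpos := integral_exp_pos_of_ae_bounded hE hEb
  rw [gibbsAvg, abs_div, abs_of_pos hpos, div_le_iff₀ hpos, ← integral_const_mul]
  refine norm_integral_le_of_norm_le (f := fun σ => m σ * Real.exp (E σ))
    ((integrable_exp_of_ae_bounded hE hEb).const_mul A) (hmb.mono fun σ h => ?_)
  rw [Real.norm_eq_abs, abs_mul, Real.abs_exp]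
  exact mul_le_mul_of_nonneg_right h (Real.exp_pos _).le

/-- Differentiation of `∫ m exp (E s) dP` with respect to the parameter `s`. -/
lemma hasDerivAt_integral_mul_exp {E E' : ℝ → S → ℝ} {s₀ : ℝ} {U : Set ℝ} (hU : U ∈ nhds s₀)
    (hm : Measurable m) (hmb : ∀ᵐ σ ∂P, |m σ| ≤ A)
    (hE : ∀ s, Measurable (E s)) (hE' : Measurable (E' s₀))
    (hEb : ∀ᵐ σ ∂P, ∀ s ∈ U, |E s σ| ≤ C) (hEb' : ∀ᵐ σ ∂P, ∀ s ∈ U, |E' s σ| ≤ C)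
    (hd : ∀ σ, ∀ s ∈ U, HasDerivAt (fun s => E s σ) (E' s σ) s) :
    HasDerivAt (fun s => ∫ σ, m σ * Real.exp (E s σ) ∂P)
      (∫ σ, (m σ * E' s₀ σ) * Real.exp (E s₀ σ) ∂P) s₀ := by
  refine (hasDerivAt_integral_of_dominated_loc_of_deriv_le
    (F' := fun s σ => (m σ * E' s σ) * Real.exp (E s σ))
    (bound := fun _ => A * C * Real.exp C) hU
    (Filter.Eventually.of_forall fun s => (hm.mul (hE s).exp).aestronglyMeasurable)
    (integrable_mul_exp hm (hE s₀) hmb (hEb.mono fun σ h => h s₀ (mem_of_mem_nhds hU)))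
    ((hm.mul hE').mul (hE s₀).exp).aestronglyMeasurable ?_ (integrable_const _)
    (Filter.Eventually.of_forall fun σ s hs => ?_)).2
  · filter_upwards [hmb, hEb, hEb'] with σ h1 h2 h3 s hs
    have hA : 0 ≤ A := (abs_nonneg _).trans h1
    have hC : 0 ≤ C := (abs_nonneg _).trans (h3 s hs)
    rw [Real.norm_eq_abs, abs_mul, abs_mul, Real.abs_exp]
    exact mul_le_mul (mul_le_mul h1 (h3 s hs) (abs_nonneg _) hA)
      (Real.exp_le_exp.2 (abs_le.1 (h2 s hs)).2) (Real.exp_pos _).le (mul_nonneg hA hC)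
  · refine (((hd σ s hs).exp).const_mul (m σ)).congr_deriv ?_
    ring

lemma hasDerivAt_log_integral_exp {E E' : ℝ → S → ℝ} {s₀ : ℝ} {U : Set ℝ} (hU : U ∈ nhds s₀)
    (hE : ∀ s, Measurable (E s)) (hE' : Measurable (E' s₀))
    (hEb : ∀ᵐ σ ∂P, ∀ s ∈ U, |E s σ| ≤ C) (hEb' : ∀ᵐ σ ∂P, ∀ s ∈ U, |E' s σ| ≤ C)
    (hd : ∀ σ, ∀ s ∈ U, HasDerivAt (fun s => E s σ) (E' s σ) s) :
    HasDerivAt (fun s => Real.log (∫ σ, Real.exp (E s σ) ∂P)) (gibbsAvg P (E s₀) (E' s₀)) s₀ := by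
  have h := hasDerivAt_integral_mul_exp (P := P) (m := fun _ => 1) (A := 1) hU measurable_const
    (by simp) hE hE' hEb hEb' hd
  simp only [one_mul] at h
  exact h.log (integral_exp_pos_of_ae_bounded (hE s₀)
    (hEb.mono fun σ h => h s₀ (mem_of_mem_nhds hU))).ne'

/-- The derivative of a Gibbs average in the direction of its own observable is the Gibbs
variance. -/
lemma hasDerivAt_gibbsAvg {a V : S → ℝ} {B : ℝ} (c y : ℝ) (ha : Measurable a) (hV : Measurable V)
    (hab : ∀ᵐ σ ∂P, |a σ| ≤ A) (hVb : ∀ᵐ σ ∂P, |V σ| ≤ B) :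
    HasDerivAt (fun y => gibbsAvg P (fun σ => c * (y * a σ) + V σ) a)
      (c * (gibbsAvg P (fun σ => c * (y * a σ) + V σ) (fun σ => a σ ^ 2)
        - gibbsAvg P (fun σ => c * (y * a σ) + V σ) a ^ 2)) y := by
  have hE : ∀ s : ℝ, Measurable fun σ => c * (s * a σ) + V σ := fun s =>
    ((ha.const_mul s).const_mul c).add hV
  set C : ℝ := max (|c| * ((|y| + 1) * A) + B) (|c| * A)
  have hU : Metric.ball y 1 ∈ nhds y := Metric.ball_mem_nhds y one_pos
  have hEb : ∀ᵐ σ ∂P, ∀ s ∈ Metric.ball y 1, |c * (s * a σ) + V σ| ≤ C := by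
    filter_upwards [hab, hVb] with σ h1 h2 s hs
    have hs' : |s| ≤ |y| + 1 := by
      have h3 : |s - y| < 1 := hs
      have h4 := abs_sub_abs_le_abs_sub s y
      linarith
    refine le_max_of_le_left ((abs_add_le _ _).trans (add_le_add ?_ h2))
    rw [abs_mul, abs_mul]
    gcongr
  have hEb' : ∀ᵐ σ ∂P, ∀ s ∈ Metric.ball y 1, |c * a σ| ≤ C := by
    filter_upwards [hab] with σ h1 s _
    refine le_max_of_le_right ?_
    rw [abs_mul]
    gcongr
  have hd : ∀ σ, ∀ s ∈ Metric.ball y 1,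
      HasDerivAt (fun s => c * (s * a σ) + V σ) (c * a σ) s := fun σ s _ => by
    simpa using ((((hasDerivAt_id s).mul_const (a σ)).const_mul c).add_const (V σ))
  have hEy : ∀ᵐ σ ∂P, |c * (y * a σ) + V σ| ≤ C :=
    hEb.mono fun σ h => h y (mem_of_mem_nhds hU)
  have hpos := integral_exp_pos_of_ae_bounded (hE y) hEy
  have h1 := hasDerivAt_integral_mul_exp (E' := fun _ σ => c * a σ) hU ha hab hE
    (ha.const_mul c) hEb hEb' hd
  have h2 := hasDerivAt_integral_mul_exp (P := P) (m := fun _ => 1) (A := 1)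
    (E' := fun _ σ => c * a σ) hU measurable_const (by simp) hE (ha.const_mul c) hEb hEb' hd
  simp only [one_mul] at h2
  refine (h1.div h2 hpos.ne').congr_deriv ?_
  have e1 : ∫ σ, a σ * (c * a σ) * Real.exp (c * (y * a σ) + V σ) ∂P
      = c * ∫ σ, a σ ^ 2 * Real.exp (c * (y * a σ) + V σ) ∂P := by
    rw [← integral_const_mul]
    congr 1 with σ
    ring
  have e2 : ∫ σ, c * a σ * Real.exp (c * (y * a σ) + V σ) ∂P
      = c * ∫ σ, a σ * Real.exp (c * (y * a σ) + V σ) ∂P := by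
    rw [← integral_const_mul]
    congr 1 with σ
    ring
  simp only [gibbsAvg, e1, e2]
  generalize ∫ σ, Real.exp (c * (y * a σ) + V σ) ∂P = Z at hpos ⊢
  generalize ∫ σ, a σ * Real.exp (c * (y * a σ) + V σ) ∂P = M₁
  generalize ∫ σ, a σ ^ 2 * Real.exp (c * (y * a σ) + V σ) ∂P = M₂
  field_simp

end GibbsAverage

section GaussianTilt

variable {ι S T : Type*} [Fintype ι]

/-- Exponent with a normalized Gaussian field of covariance `2t ∑ k, a k σ * a k τ` and an
additional potential `W`. -/
noncomputable def gaussExponent (a : ι → S → ℝ) (W : S → T → ℝ) (t : ℝ) (ω : (ι → ℝ) × T)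
    (σ : S) : ℝ :=
  √(2 * t) * ∑ k, ω.1 k * a k σ - t * ∑ k, a k σ ^ 2 + W σ ω.2

variable {a : ι → S → ℝ} {W : S → T → ℝ} {A : ℝ} {B : T → ℝ}

lemma abs_sum_mul_le {σ : S} (h : ∀ k, |a k σ| ≤ A) (J : ι → ℝ) :
    |∑ k, J k * a k σ| ≤ A * ∑ k, |J k| := by
  rw [Finset.mul_sum]
  refine (Finset.abs_sum_le_sum_abs _ _).trans (Finset.sum_le_sum fun k _ => ?_)
  rw [abs_mul, mul_comm]
  exact mul_le_mul_of_nonneg_right (h k) (abs_nonneg _)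

lemma abs_sum_sq_le {σ : S} (h : ∀ k, |a k σ| ≤ A) :
    |∑ k, a k σ ^ 2| ≤ Fintype.card ι * A ^ 2 := by
  refine (Finset.abs_sum_le_sum_abs _ _).trans ?_
  calc ∑ k, |a k σ ^ 2| ≤ ∑ _k : ι, A ^ 2 := Finset.sum_le_sum fun k _ => by
        rw [abs_pow]
        exact pow_le_pow_left₀ (abs_nonneg _) (h k) 2
    _ = Fintype.card ι * A ^ 2 := by simp

lemma abs_gaussExponent_le {σ : S} (h : ∀ k, |a k σ| ≤ A)
    (hW : ∀ w, |W σ w| ≤ B w) {t t₁ : ℝ} (ht : 0 ≤ t) (ht₁ : t ≤ t₁) (ω : (ι → ℝ) × T) :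
    |gaussExponent a W t ω σ|
      ≤ √(2 * t₁) * (A * ∑ k, |ω.1 k|) + t₁ * (Fintype.card ι * A ^ 2) + B ω.2 := by
  refine (abs_add_le _ _).trans (add_le_add ((abs_sub _ _).trans (add_le_add ?_ ?_)) (hW _))
  · rw [abs_mul, abs_of_nonneg (Real.sqrt_nonneg _)]
    exact mul_le_mul (Real.sqrt_le_sqrt (by linarith)) (abs_sum_mul_le h _) (abs_nonneg _)
      (Real.sqrt_nonneg _)
  · rw [abs_mul, abs_of_nonneg ht]
    exact mul_le_mul ht₁ (abs_sum_sq_le h) (abs_nonneg _) (ht.trans ht₁)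

lemma gaussExponent_update [DecidableEq ι] (t : ℝ) (J : ι → ℝ) (w : T) (k : ι) (y : ℝ) (σ : S) :
    gaussExponent a W t (Function.update J k y, w) σ
      = √(2 * t) * (y * a k σ) + gaussExponent a W t (Function.update J k 0, w) σ := by
  have h : ∀ z : ℝ, ∑ i, Function.update J k z i * a i σ
      = z * a k σ + ∑ i ∈ Finset.univ.erase k, J i * a i σ := fun z => by
    rw [← Finset.add_sum_erase _ _ (Finset.mem_univ k), Function.update_self]
    congr 1
    refine Finset.sum_congr rfl fun i hi => ?_
    rw [Function.update_of_ne (Finset.ne_of_mem_erase hi)]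
  simp only [gaussExponent, h]
  ring

lemma hasDerivAt_gaussExponent {t : ℝ} (ht : 0 < t) (ω : (ι → ℝ) × T) (σ : S) :
    HasDerivAt (fun t => gaussExponent a W t ω σ)
      ((√(2 * t))⁻¹ * ∑ k, ω.1 k * a k σ - ∑ k, a k σ ^ 2) t := by
  have h1 : HasDerivAt (fun t : ℝ => √(2 * t)) ((√(2 * t))⁻¹) t := by
    refine (((hasDerivAt_id t).const_mul 2).sqrt (by simpa using ht.ne')).congr_deriv ?_
    simp
    ring
  refine (((h1.mul_const (∑ k, ω.1 k * a k σ)).sub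
    ((hasDerivAt_id t).mul_const (∑ k, a k σ ^ 2))).add_const (W σ ω.2)).congr_deriv ?_
  rw [one_mul]

variable [MeasurableSpace S] [MeasurableSpace T]

lemma measurable_uncurry_gaussExponent (ha : ∀ k, Measurable (a k))
    (hW : Measurable (Function.uncurry W)) (t : ℝ) :
    Measurable (Function.uncurry (gaussExponent a W t)) := by
  unfold gaussExponent Function.uncurry
  have hW' : Measurable fun q : ((ι → ℝ) × T) × S => W q.2 q.1.2 :=
    hW.comp (measurable_snd.prodMk (measurable_snd.comp measurable_fst))
  have ha' : ∀ k, Measurable fun q : ((ι → ℝ) × T) × S => a k q.2 := fun k =>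
    (ha k).comp measurable_snd
  have hc : ∀ k, Measurable fun q : ((ι → ℝ) × T) × S => q.1.1 k := fun k =>
    (measurable_pi_apply k).comp (measurable_fst.comp measurable_fst)
  refine ((Measurable.const_mul ?_ _).sub (Measurable.const_mul ?_ _)).add hW'
  · exact Finset.measurable_fun_sum _ fun k _ => (hc k).mul (ha' k)
  · exact Finset.measurable_fun_sum _ fun k _ => (ha' k).pow_const 2

lemma measurable_gaussExponent (ha : ∀ k, Measurable (a k))
    (hW : Measurable (Function.uncurry W)) (t : ℝ) (ω : (ι → ℝ) × T) :
    Measurable (gaussExponent a W t ω) :=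
  (measurable_uncurry_gaussExponent ha hW t).of_uncurry_left

lemma measurable_gibbsAvg_of_uncurry {Ω : Type*} [MeasurableSpace Ω] {P : Measure S} [SFinite P]
    {E m : Ω → S → ℝ} (hE : Measurable (Function.uncurry E))
    (hm : Measurable (Function.uncurry m)) :
    Measurable fun ω => gibbsAvg P (E ω) (m ω) := by
  have h1 : StronglyMeasurable fun ω => ∫ σ, m ω σ * Real.exp (E ω σ) ∂P :=
    StronglyMeasurable.integral_prod_right (hm.mul hE.exp).stronglyMeasurable
  have h2 : StronglyMeasurable fun ω => ∫ σ, Real.exp (E ω σ) ∂P :=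
    StronglyMeasurable.integral_prod_right hE.exp.stronglyMeasurable
  exact h1.measurable.div h2.measurable

variable {P : Measure S} [IsProbabilityMeasure P] {ν : Measure T} [IsProbabilityMeasure ν]

lemma integrable_abs_apply_prod (ν : Measure T) [IsProbabilityMeasure ν] (k : ι) :
    Integrable (fun ω : (ι → ℝ) × T => |ω.1 k|)
      ((Measure.pi fun _ : ι => gaussianReal 0 1).prod ν) := by
  have h : Integrable (fun J : ι → ℝ => |J k|) (Measure.pi fun _ : ι => gaussianReal 0 1) :=
    integrable_comp_eval (μ := fun _ : ι => gaussianReal 0 1) (i := k) (f := fun x : ℝ => |x|)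
      ((memLp_id_gaussianReal 1).integrable (by simp)).abs
  exact h.comp_fst ν

/-- Gaussian integration by parts for the Gibbs average of a component of the Gaussian field. -/
lemma integral_apply_mul_gibbsAvg [DecidableEq ι] (ha : ∀ k, Measurable (a k))
    (hW : Measurable (Function.uncurry W)) (haA : ∀ᵐ σ ∂P, ∀ k, |a k σ| ≤ A)
    (hWB : ∀ᵐ σ ∂P, ∀ w, |W σ w| ≤ B w) {t : ℝ} (ht : 0 ≤ t) (k : ι) :
    ∫ ω, ω.1 k * gibbsAvg P (gaussExponent a W t ω) (a k)
        ∂((Measure.pi fun _ : ι => gaussianReal 0 1).prod ν)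
      = ∫ ω, √(2 * t) * (gibbsAvg P (gaussExponent a W t ω) (fun σ => a k σ ^ 2)
          - gibbsAvg P (gaussExponent a W t ω) (a k) ^ 2)
        ∂((Measure.pi fun _ : ι => gaussianReal 0 1).prod ν) := by
  have hEm := measurable_uncurry_gaussExponent ha hW t
  have hEb : ∀ ω, ∀ᵐ σ ∂P, |gaussExponent a W t ω σ|
      ≤ √(2 * t) * (A * ∑ k, |ω.1 k|) + t * (Fintype.card ι * A ^ 2) + B ω.2 := fun ω => by
    filter_upwards [haA, hWB] with σ h1 h2
    exact abs_gaussExponent_le h1 h2 ht le_rfl ω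
  have hak : ∀ᵐ σ ∂P, |a k σ| ≤ A := haA.mono fun σ h => h k
  have hak2 : ∀ᵐ σ ∂P, |a k σ ^ 2| ≤ A ^ 2 := hak.mono fun σ h => by
    rw [abs_pow]
    exact pow_le_pow_left₀ (abs_nonneg _) h 2
  set G : (ι → ℝ) × T → ℝ := fun ω => gibbsAvg P (gaussExponent a W t ω) (a k) with hGdef
  set Q : (ι → ℝ) × T → ℝ :=
    fun ω => gibbsAvg P (gaussExponent a W t ω) (fun σ => a k σ ^ 2) with hQdef
  have hG : Measurable G :=
    measurable_gibbsAvg_of_uncurry (m := fun _ => a k) hEm ((ha k).comp measurable_snd)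
  have hQ : Measurable Q :=
    measurable_gibbsAvg_of_uncurry (m := fun _ σ => a k σ ^ 2) hEm
      (((ha k).pow_const 2).comp measurable_snd)
  have hD : Measurable fun ω => √(2 * t) * (Q ω - G ω ^ 2) :=
    (hQ.sub (hG.pow_const 2)).const_mul _
  have hGb : ∀ ω, |G ω| ≤ A := fun ω =>
    abs_gibbsAvg_le (measurable_gaussExponent ha hW t ω) hak (hEb ω)
  have hDb : ∀ ω, |√(2 * t) * (Q ω - G ω ^ 2)| ≤ √(2 * t) * (A ^ 2 + A ^ 2) := fun ω => by
    rw [abs_mul, abs_of_nonneg (Real.sqrt_nonneg _)]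
    refine mul_le_mul_of_nonneg_left ((abs_sub _ _).trans (add_le_add ?_ ?_)) (Real.sqrt_nonneg _)
    · exact abs_gibbsAvg_le (measurable_gaussExponent ha hW t ω) hak2 (hEb ω)
    · rw [abs_pow]
      exact pow_le_pow_left₀ (abs_nonneg _) (hGb ω) 2
  have hc : Measurable fun ω : (ι → ℝ) × T => ω.1 k :=
    (measurable_pi_apply k).comp measurable_fst
  have hint : Integrable (fun ω : (ι → ℝ) × T => ω.1 k * G ω)
      ((Measure.pi fun _ : ι => gaussianReal 0 1).prod ν) :=
    ((integrable_norm_iff hc.aestronglyMeasurable).1 (integrable_abs_apply_prod ν k)).mul_bdd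
      hG.aestronglyMeasurable (Filter.Eventually.of_forall hGb)
  rw [integral_prod_symm _ hint, integral_prod_symm _ (Integrable.of_bound
    hD.aestronglyMeasurable _ (Filter.Eventually.of_forall hDb))]
  congr 1 with w
  refine integral_apply_mul_pi_gaussianReal k (G := fun J => G (J, w))
    (D := fun J => √(2 * t) * (Q (J, w) - G (J, w) ^ 2))
    (C := max A (√(2 * t) * (A ^ 2 + A ^ 2))) (hG.comp measurable_prodMk_right)
    (hD.comp measurable_prodMk_right)
    (fun J => (hGb _).trans (le_max_left _ _)) (fun J => (hDb _).trans (le_max_right _ _))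
    fun J y => ?_
  have := hasDerivAt_gibbsAvg (√(2 * t)) y (ha k)
    (measurable_gaussExponent ha hW t (Function.update J k 0, w)) hak (hEb _)
  have e : ∀ z : ℝ, gaussExponent a W t (Function.update J k z, w)
      = fun σ => √(2 * t) * (z * a k σ) + gaussExponent a W t (Function.update J k 0, w) σ :=
    fun z => funext fun σ => gaussExponent_update t J w k z σ
  have e' : (fun z => G (Function.update J k z, w)) = fun z => gibbsAvg P (fun σ =>
      √(2 * t) * (z * a k σ) + gaussExponent a W t (Function.update J k 0, w) σ) (a k) :=
    funext fun z => by rw [← e z]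
  rw [e']
  simp only [hGdef, hQdef]
  rw [e y]
  exact this

/-- The derivative in the variance parameter of the averaged logarithmic partition function. -/
theorem hasDerivAt_integral_log_integral_exp_gaussExponent (ha : ∀ k, Measurable (a k))
    (hW : Measurable (Function.uncurry W)) (haA : ∀ᵐ σ ∂P, ∀ k, |a k σ| ≤ A)
    (hWB : ∀ᵐ σ ∂P, ∀ w, |W σ w| ≤ B w) (hB : Integrable B ν) {t : ℝ} (ht : 0 < t) :
    HasDerivAt (fun t => ∫ ω, Real.log (∫ σ, Real.exp (gaussExponent a W t ω σ) ∂P)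
        ∂((Measure.pi fun _ : ι => gaussianReal 0 1).prod ν))
      (-∫ ω, ∑ k, gibbsAvg P (gaussExponent a W t ω) (a k) ^ 2
        ∂((Measure.pi fun _ : ι => gaussianReal 0 1).prod ν)) t := by
  classical
  set μ := (Measure.pi fun _ : ι => gaussianReal 0 1).prod ν
  have hEm := fun s => measurable_uncurry_gaussExponent ha hW s
  have hEm' := fun s ω => measurable_gaussExponent ha hW s ω
  set E' : ℝ → (ι → ℝ) × T → S → ℝ :=
    fun s ω σ => (√(2 * s))⁻¹ * ∑ k, ω.1 k * a k σ - ∑ k, a k σ ^ 2 with hE'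
  have hE'm : ∀ s, Measurable (Function.uncurry (E' s)) := fun s => by
    refine (Measurable.const_mul (Finset.measurable_fun_sum _ fun k _ => Measurable.mul ?_ ?_)
      _).sub (Finset.measurable_fun_sum _ fun k _ => Measurable.pow_const ?_ 2)
    · exact (measurable_pi_apply k).comp (measurable_fst.comp measurable_fst)
    · exact (ha k).comp measurable_snd
    · exact (ha k).comp measurable_snd
  have hE'm' : ∀ s ω, Measurable (E' s ω) := fun s ω => (hE'm s).of_uncurry_left
  have hU : Set.Ioo (t / 2) (2 * t) ∈ nhds t := Ioo_mem_nhds (by linarith) (by linarith)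
  set b : (ι → ℝ) × T → ℝ := fun ω =>
    √(2 * (2 * t)) * (A * ∑ k, |ω.1 k|) + 2 * t * (Fintype.card ι * A ^ 2) + B ω.2
  set b' : (ι → ℝ) × T → ℝ := fun ω =>
    (√t)⁻¹ * (A * ∑ k, |ω.1 k|) + Fintype.card ι * A ^ 2
  have hJ : Integrable (fun ω : (ι → ℝ) × T => A * ∑ k, |ω.1 k|) μ :=
    (integrable_finsetSum _ fun k _ => integrable_abs_apply_prod ν k).const_mul A
  have hbi : Integrable b μ :=
    ((hJ.const_mul _).add (integrable_const _)).add (hB.comp_snd _)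
  have hb'i : Integrable b' μ := (hJ.const_mul _).add (integrable_const _)
  have hEb : ∀ᵐ σ ∂P, ∀ ω, ∀ s ∈ Set.Ioo (t / 2) (2 * t), |gaussExponent a W s ω σ| ≤ b ω := by
    filter_upwards [haA, hWB] with σ h1 h2 ω s hs
    exact abs_gaussExponent_le h1 h2 (by linarith [hs.1]) hs.2.le ω
  have hEb' : ∀ᵐ σ ∂P, ∀ ω, ∀ s ∈ Set.Ioo (t / 2) (2 * t), |E' s ω σ| ≤ b' ω := by
    filter_upwards [haA] with σ h1 ω s hs
    refine (abs_sub _ _).trans (add_le_add ?_ (abs_sum_sq_le h1))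
    rw [abs_mul, abs_of_nonneg (inv_nonneg.2 (Real.sqrt_nonneg _))]
    refine mul_le_mul (inv_anti₀ (Real.sqrt_pos.2 ht) (Real.sqrt_le_sqrt (by linarith [hs.1])))
      (abs_sum_mul_le h1 _) (abs_nonneg _) (inv_nonneg.2 (Real.sqrt_nonneg _))
  have hEbs : ∀ ω, ∀ s ∈ Set.Ioo (t / 2) (2 * t), ∀ᵐ σ ∂P, |gaussExponent a W s ω σ| ≤ b ω :=
    fun ω s hs => hEb.mono fun σ h => h ω s hs
  have htU : t ∈ Set.Ioo (t / 2) (2 * t) := mem_of_mem_nhds hU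
  have hlogm : ∀ s, AEStronglyMeasurable
      (fun ω => Real.log (∫ σ, Real.exp (gaussExponent a W s ω σ) ∂P)) μ := fun s =>
    ((StronglyMeasurable.integral_prod_right (f := fun ω σ => Real.exp (gaussExponent a W s ω σ))
      (hEm s).exp.stronglyMeasurable).measurable.log).aestronglyMeasurable
  have hmain := (hasDerivAt_integral_of_dominated_loc_of_deriv_le (μ := μ)
    (F := fun s ω => Real.log (∫ σ, Real.exp (gaussExponent a W s ω σ) ∂P))
    (F' := fun s ω => gibbsAvg P (gaussExponent a W s ω) (E' s ω)) (bound := b') hU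
    (Filter.Eventually.of_forall hlogm)
    (hbi.mono' (hlogm t) (Filter.Eventually.of_forall fun ω =>
      abs_log_integral_exp_le (hEm' t ω) (hEbs ω t htU)))
    (measurable_gibbsAvg_of_uncurry (hEm t) (hE'm t)).aestronglyMeasurable
    (Filter.Eventually.of_forall fun ω s hs => abs_gibbsAvg_le (hEm' s ω)
      (hEb'.mono fun σ h => h ω s hs) (hEbs ω s hs)) hb'i
    (Filter.Eventually.of_forall fun ω s hs => hasDerivAt_log_integral_exp
      (E := fun s => gaussExponent a W s ω) (E' := fun s => E' s ω) (C := max (b ω) (b' ω))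
      (isOpen_Ioo.mem_nhds hs) (fun s => hEm' s ω) (hE'm' s ω)
      (hEb.mono fun σ h s hs => (h ω s hs).trans (le_max_left _ _))
      (hEb'.mono fun σ h s hs => (h ω s hs).trans (le_max_right _ _))
      fun σ s hs => hasDerivAt_gaussExponent (by linarith [hs.1]) ω σ)).2
  refine hmain.congr_deriv ?_
  have hsplit : ∀ ω, gibbsAvg P (gaussExponent a W t ω) (E' t ω)
      = ∑ k, ((√(2 * t))⁻¹ * (ω.1 k * gibbsAvg P (gaussExponent a W t ω) (a k))
        - gibbsAvg P (gaussExponent a W t ω) (fun σ => a k σ ^ 2)) := fun ω => by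
    have hi1 : ∀ k, Integrable (fun σ => a k σ * Real.exp (gaussExponent a W t ω σ)) P := fun k =>
      integrable_mul_exp (ha k) (hEm' t ω) (haA.mono fun σ h => h k) (hEbs ω t htU)
    have hi2 : ∀ k, Integrable (fun σ => a k σ ^ 2 * Real.exp (gaussExponent a W t ω σ)) P :=
      fun k => integrable_mul_exp (A := A ^ 2) ((ha k).pow_const 2) (hEm' t ω)
        (haA.mono fun σ h => by
          rw [abs_pow]
          exact pow_le_pow_left₀ (abs_nonneg _) (h k) 2) (hEbs ω t htU)
    have hnum : ∫ σ, E' t ω σ * Real.exp (gaussExponent a W t ω σ) ∂P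
        = ∑ k, ((√(2 * t))⁻¹ * (ω.1 k * ∫ σ, a k σ * Real.exp (gaussExponent a W t ω σ) ∂P)
          - ∫ σ, a k σ ^ 2 * Real.exp (gaussExponent a W t ω σ) ∂P) := by
      have hi3 : ∀ k, Integrable (fun σ =>
          (√(2 * t))⁻¹ * (ω.1 k * (a k σ * Real.exp (gaussExponent a W t ω σ)))
            - a k σ ^ 2 * Real.exp (gaussExponent a W t ω σ)) P := fun k =>
        (((hi1 k).const_mul (ω.1 k)).const_mul (√(2 * t))⁻¹).sub (hi2 k)
      simp_rw [← integral_const_mul]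
      rw [Finset.sum_congr rfl fun k _ =>
        (integral_sub (((hi1 k).const_mul (ω.1 k)).const_mul (√(2 * t))⁻¹) (hi2 k)).symm,
        ← integral_finsetSum _ fun k _ => hi3 k]
      congr 1 with σ
      simp only [hE', Finset.mul_sum, ← Finset.sum_sub_distrib, Finset.sum_mul]
      refine Finset.sum_congr rfl fun k _ => ?_
      ring
    rw [gibbsAvg, hnum, Finset.sum_div]
    refine Finset.sum_congr rfl fun k _ => ?_
    simp only [gibbsAvg]
    ring
  have hGm : ∀ k, Measurable fun ω => gibbsAvg P (gaussExponent a W t ω) (a k) := fun k =>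
    measurable_gibbsAvg_of_uncurry (m := fun _ => a k) (hEm t) ((ha k).comp measurable_snd)
  have hQm : ∀ k, Measurable fun ω =>
      gibbsAvg P (gaussExponent a W t ω) (fun σ => a k σ ^ 2) := fun k =>
    measurable_gibbsAvg_of_uncurry (m := fun _ σ => a k σ ^ 2) (hEm t)
      (((ha k).pow_const 2).comp measurable_snd)
  have hGb : ∀ k ω, |gibbsAvg P (gaussExponent a W t ω) (a k)| ≤ A := fun k ω =>
    abs_gibbsAvg_le (hEm' t ω) (haA.mono fun σ h => h k) (hEbs ω t htU)
  have hQi : ∀ k, Integrable (fun ω =>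
      gibbsAvg P (gaussExponent a W t ω) (fun σ => a k σ ^ 2)) μ := fun k =>
    Integrable.of_bound (hQm k).aestronglyMeasurable (A ^ 2)
      (Filter.Eventually.of_forall fun ω => abs_gibbsAvg_le (hEm' t ω)
        (haA.mono fun σ h => by
          rw [abs_pow]
          exact pow_le_pow_left₀ (abs_nonneg _) (h k) 2) (hEbs ω t htU))
  have hG2i : ∀ k, Integrable (fun ω =>
      gibbsAvg P (gaussExponent a W t ω) (a k) ^ 2) μ := fun k =>
    Integrable.of_bound ((hGm k).pow_const 2).aestronglyMeasurable (A ^ 2)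
      (Filter.Eventually.of_forall fun ω => by
        rw [Real.norm_eq_abs, abs_pow]
        exact pow_le_pow_left₀ (abs_nonneg _) (hGb k ω) 2)
  have hJG : ∀ k, Integrable (fun ω : (ι → ℝ) × T =>
      ω.1 k * gibbsAvg P (gaussExponent a W t ω) (a k)) μ := fun k =>
    ((integrable_norm_iff ((measurable_pi_apply k).comp
      measurable_fst).aestronglyMeasurable).1 (integrable_abs_apply_prod ν k)).mul_bdd
      (hGm k).aestronglyMeasurable (Filter.Eventually.of_forall (hGb k))
  have hpos : √(2 * t) ≠ 0 := (Real.sqrt_pos.2 (by linarith)).ne'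
  have hterm : ∀ k, Integrable (fun ω : (ι → ℝ) × T =>
      (√(2 * t))⁻¹ * (ω.1 k * gibbsAvg P (gaussExponent a W t ω) (a k))
        - gibbsAvg P (gaussExponent a W t ω) (fun σ => a k σ ^ 2)) μ := fun k =>
    ((hJG k).const_mul _).sub (hQi k)
  simp only [hsplit]
  rw [integral_finsetSum _ fun k _ => hterm k, integral_finsetSum _ fun k _ => hG2i k,
    ← Finset.sum_neg_distrib]
  refine Finset.sum_congr rfl fun k _ => ?_
  rw [integral_sub ((hJG k).const_mul _) (hQi k), integral_const_mul,
    integral_apply_mul_gibbsAvg ha hW haA hWB ht.le k, integral_const_mul,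
    inv_mul_cancel_left₀ hpos, integral_sub (hQi k) (hG2i k)]
  ring

end GaussianTilt

section Replicas

variable {ι S : Type*} [Fintype ι] [MeasurableSpace S] {P : Measure S} [IsProbabilityMeasure P]
  {a : ι → S → ℝ} {E : S → ℝ} {A C : ℝ}

/-- The two-replica average of an overlap is a sum of squares of one-replica averages. -/
lemma integral_integral_overlap_div (c : ℝ) (ha : ∀ k, Measurable (a k)) (hE : Measurable E)
    (haA : ∀ᵐ σ ∂P, ∀ k, |a k σ| ≤ A) (hEb : ∀ᵐ σ ∂P, |E σ| ≤ C) :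
    (∫ σ, ∫ σ', (c * ∑ k, a k σ * a k σ') * Real.exp (E σ + E σ') ∂P ∂P)
        / (∫ σ, Real.exp (E σ) ∂P) ^ 2
      = c * ∑ k, gibbsAvg P E (a k) ^ 2 := by
  have hi : ∀ k, Integrable (fun σ => a k σ * Real.exp (E σ)) P := fun k =>
    integrable_mul_exp (ha k) hE (haA.mono fun σ h => h k) hEb
  have inner : ∀ σ, ∫ σ', (c * ∑ k, a k σ * a k σ') * Real.exp (E σ + E σ') ∂P
      = c * ∑ k, (a k σ * Real.exp (E σ)) * ∫ σ', a k σ' * Real.exp (E σ') ∂P := fun σ => by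
    simp_rw [← integral_const_mul]
    rw [← integral_finsetSum _ fun k _ => (hi k).const_mul _, ← integral_const_mul]
    congr 1 with σ'
    rw [Real.exp_add, mul_assoc, Finset.sum_mul]
    congr 1
    refine Finset.sum_congr rfl fun k _ => ?_
    ring
  simp_rw [inner]
  rw [integral_const_mul, integral_finsetSum _ fun k _ => (hi k).mul_const _, mul_div_assoc,
    Finset.sum_div]
  congr 1
  refine Finset.sum_congr rfl fun k _ => ?_
  rw [integral_mul_const, gibbsAvg, div_pow, sq (∫ σ, a k σ * Real.exp (E σ) ∂P)]

end Replicas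

section MixedSpin

variable {n N : ℕ} {β : ℕ → ℝ}

/-- The coefficient of the disorder variable `J k` in the Hamiltonian. -/
noncomputable def spinCoeff (n : ℕ) (β : ℕ → ℝ) (N : ℕ) (k : SpinIdx n N) (σ : Fin N → ℝ) : ℝ :=
  √(β k.1) * (N : ℝ) ^ (((1 : ℝ) - (k.1 : ℕ)) / 2) * ∏ j, σ (k.2 j)

lemma hamiltonian_eq_sum (σ : Fin N → ℝ) (J : SpinIdx n N → ℝ) :
    hamiltonian n β N σ J = ∑ k, J k * spinCoeff n β N k σ := by
  rw [hamiltonian, Fintype.sum_sigma]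
  refine Finset.sum_congr rfl fun p _ => ?_
  rw [Finset.mul_sum]
  refine Finset.sum_congr rfl fun i _ => ?_
  rw [spinCoeff]
  ring

lemma sum_spinCoeff_mul (hβ : ∀ p, 0 ≤ β p) (hN : 1 ≤ N) (σ τ : Fin N → ℝ) :
    ∑ k, spinCoeff n β N k σ * spinCoeff n β N k τ = N * xi n β ((∑ i, σ i * τ i) / N) := by
  have hN0 : (0 : ℝ) < N := by exact_mod_cast hN
  rw [Fintype.sum_sigma, xi, Finset.mul_sum, Finset.sum_subtype (Finset.Icc 2 n) (fun _ => Iff.rfl)]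
  refine Finset.sum_congr rfl fun p _ => ?_
  have hpow : (N : ℝ) ^ (((1 : ℝ) - (p : ℕ)) / 2) * (N : ℝ) ^ (((1 : ℝ) - (p : ℕ)) / 2)
      = N / (N : ℝ) ^ (p : ℕ) := by
    rw [← Real.rpow_add hN0, add_halves, Real.rpow_sub hN0, Real.rpow_one, Real.rpow_natCast]
  calc ∑ i : Fin (p : ℕ) → Fin N, spinCoeff n β N ⟨p, i⟩ σ * spinCoeff n β N ⟨p, i⟩ τ
      = ∑ i : Fin (p : ℕ) → Fin N, (√(β p) * √(β p)) *
          ((N : ℝ) ^ (((1 : ℝ) - (p : ℕ)) / 2) * (N : ℝ) ^ (((1 : ℝ) - (p : ℕ)) / 2)) *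
          ∏ j, σ (i j) * τ (i j) := by
        refine Finset.sum_congr rfl fun i _ => ?_
        rw [Finset.prod_mul_distrib, spinCoeff, spinCoeff]
        ring
    _ = β p * (N / (N : ℝ) ^ (p : ℕ)) * (∑ i, σ i * τ i) ^ (p : ℕ) := by
        rw [← Finset.mul_sum, Real.mul_self_sqrt (hβ p), hpow, Fintype.sum_pow]
    _ = N * (β p * ((∑ i, σ i * τ i) / N) ^ (p : ℕ)) := by
        rw [div_pow]
        ring

lemma sum_spinCoeff_sq (hβ : ∀ p, 0 ≤ β p) (hN : 1 ≤ N) (σ : Fin N → ℝ) :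
    ∑ k, spinCoeff n β N k σ ^ 2 = N * xi n β ((∑ i, σ i ^ 2) / N) := by
  simpa only [sq] using sum_spinCoeff_mul hβ hN σ σ

lemma measurable_spinCoeff (k : SpinIdx n N) : Measurable (spinCoeff n β N k) :=
  (Finset.measurable_fun_prod _ fun j _ => measurable_pi_apply (k.2 j)).const_mul _

lemma exists_forall_abs_spinCoeff_le (n : ℕ) (β : ℕ → ℝ) (N : ℕ) (R : ℝ) :
    ∃ A, ∀ σ : Fin N → ℝ, (∀ i, |σ i| ≤ R) → ∀ k, |spinCoeff n β N k σ| ≤ A := by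
  have hnn : ∀ k : SpinIdx n N,
      0 ≤ |√(β k.1) * (N : ℝ) ^ (((1 : ℝ) - (k.1 : ℕ)) / 2)| * |R| ^ (k.1 : ℕ) := fun k => by
    positivity
  refine ⟨∑ k : SpinIdx n N,
    |√(β k.1) * (N : ℝ) ^ (((1 : ℝ) - (k.1 : ℕ)) / 2)| * |R| ^ (k.1 : ℕ),
    fun σ hσ k => ?_⟩
  refine le_trans ?_ (Finset.single_le_sum (fun k _ => hnn k) (Finset.mem_univ k))
  rw [spinCoeff, abs_mul, Finset.abs_prod]
  refine mul_le_mul_of_nonneg_left ?_ (abs_nonneg _)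
  calc ∏ j, |σ (k.2 j)| ≤ ∏ _j : Fin (k.1 : ℕ), |R| :=
        Finset.prod_le_prod (fun _ _ => abs_nonneg _) fun j _ => (hσ _).trans (le_abs_self R)
    _ = |R| ^ (k.1 : ℕ) := by simp

/-- The part of the enriched Hamiltonian driven by the independent field of coefficients `b`. -/
noncomputable def fieldPotential {κ S : Type*} [Fintype κ] (b : κ → S → ℝ) (h : ℝ) (σ : S)
    (z : κ → ℝ) : ℝ :=
  gaussExponent b (fun _ (_ : Unit) => 0) h (z, ()) σ

lemma measurable_uncurry_fieldPotential {κ S : Type*} [Fintype κ] [MeasurableSpace S]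
    {b : κ → S → ℝ} (hb : ∀ k, Measurable (b k)) (h : ℝ) :
    Measurable (Function.uncurry (fieldPotential b h)) := by
  unfold fieldPotential gaussExponent Function.uncurry
  refine ((Measurable.const_mul ?_ _).sub (Measurable.const_mul ?_ _)).add measurable_const
  · exact Finset.measurable_fun_sum _ fun k _ =>
      ((measurable_pi_apply k).comp measurable_snd).mul ((hb k).comp measurable_fst)
  · exact Finset.measurable_fun_sum _ fun k _ => ((hb k).comp measurable_fst).pow_const 2

/-- Derivative in `s` of the averaged log-partition function when two independent Gaussian fields
with coefficients `a` and `b` are present. -/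
lemma hasDerivAt_integral_log_two_fields {ι κ S : Type*} [Fintype ι] [Fintype κ]
    [MeasurableSpace S] {P : Measure S} [IsProbabilityMeasure P] {a : ι → S → ℝ} {b : κ → S → ℝ}
    {A B : ℝ} (ha : ∀ k, Measurable (a k)) (hb : ∀ k, Measurable (b k))
    (haA : ∀ᵐ σ ∂P, ∀ k, |a k σ| ≤ A) (hbB : ∀ᵐ σ ∂P, ∀ k, |b k σ| ≤ B)
    (c : ℝ) {s h : ℝ} (hs : 0 < s) (hh : 0 ≤ h) :
    HasDerivAt (fun s => -c * ∫ ω,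
        Real.log (∫ σ, Real.exp (gaussExponent a (fieldPotential b h) s ω σ) ∂P)
        ∂((Measure.pi fun _ : ι => gaussianReal 0 1).prod
          (Measure.pi fun _ : κ => gaussianReal 0 1)))
      (∫ ω, (∫ σ, ∫ σ', (c * ∑ k, a k σ * a k σ') *
          Real.exp (gaussExponent a (fieldPotential b h) s ω σ
            + gaussExponent a (fieldPotential b h) s ω σ') ∂P ∂P)
          / (∫ σ, Real.exp (gaussExponent a (fieldPotential b h) s ω σ) ∂P) ^ 2
        ∂((Measure.pi fun _ : ι => gaussianReal 0 1).prod
          (Measure.pi fun _ : κ => gaussianReal 0 1))) s := by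
  have hW := measurable_uncurry_fieldPotential hb h
  set Bd : (κ → ℝ) → ℝ := fun z =>
    √(2 * h) * (B * ∑ k, |z k|) + h * (Fintype.card κ * B ^ 2) + 0
  have hWB : ∀ᵐ σ ∂P, ∀ z, |fieldPotential b h σ z| ≤ Bd z := hbB.mono fun σ hσ z =>
    abs_gaussExponent_le (W := fun _ (_ : Unit) => 0) (B := fun _ => 0) hσ (by simp) hh le_rfl
      (z, ())
  have hBi : Integrable Bd (Measure.pi fun _ : κ => gaussianReal 0 1) := by
    have hc : ∀ k, Integrable (fun z : κ → ℝ => |z k|)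
        (Measure.pi fun _ : κ => gaussianReal 0 1) := fun k =>
      integrable_comp_eval (μ := fun _ : κ => gaussianReal 0 1) (i := k) (f := fun x : ℝ => |x|)
        ((memLp_id_gaussianReal 1).integrable (by simp)).abs
    exact ((((integrable_finsetSum _ fun k _ => hc k).const_mul B).const_mul _).add
      (integrable_const _)).add (integrable_const _)
  have hmain :=
    (hasDerivAt_integral_log_integral_exp_gaussExponent ha hW haA hWB hBi hs).const_mul (-c)
  refine hmain.congr_deriv ?_
  rw [neg_mul_neg, ← integral_const_mul]
  congr 1 with ω
  refine (integral_integral_overlap_div c ha (measurable_gaussExponent ha hW s ω) haA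
    (C := √(2 * s) * (A * ∑ k, |ω.1 k|) + s * (Fintype.card ι * A ^ 2) + Bd ω.2) ?_).symm
  filter_upwards [haA, hWB] with σ h1 h2
  exact abs_gaussExponent_le h1 h2 hs.le le_rfl ω

lemma enrichedH_eq_gaussExponent (hβ : ∀ p, 0 ≤ β p) (hN : 1 ≤ N) (t h : ℝ) (σ : Fin N → ℝ)
    (ω : (SpinIdx n N → ℝ) × (Fin N → ℝ)) :
    enrichedH n β N t h σ ω = gaussExponent (spinCoeff n β N)
      (fieldPotential (fun i (σ : Fin N → ℝ) => σ i) h) t ω σ := by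
  rw [enrichedH, gaussExponent, fieldPotential, gaussExponent, hamiltonian_eq_sum,
    sum_spinCoeff_sq hβ hN]
  ring

lemma enrichedH_eq_gaussExponent_swap (hβ : ∀ p, 0 ≤ β p) (hN : 1 ≤ N) (t h : ℝ)
    (σ : Fin N → ℝ) (ω : (Fin N → ℝ) × (SpinIdx n N → ℝ)) :
    enrichedH n β N t h σ ω.swap = gaussExponent (fun i (σ : Fin N → ℝ) => σ i)
      (fieldPotential (spinCoeff n β N) t) h ω σ := by
  rw [enrichedH, gaussExponent, fieldPotential, gaussExponent, hamiltonian_eq_sum,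
    sum_spinCoeff_sq hβ hN]
  simp only [Prod.fst_swap, Prod.snd_swap]
  ring

end MixedSpin

/-- Identity (2.5) of the paper: the partial derivatives of `F̄°` exist for `t, h > 0` and
`∂_t F̄° - ξ(∂_h F̄°) = E⟨ξ(σ·σ'/N)⟩ - ξ(E⟨σ·σ'/N⟩)`. -/
theorem freeEnergy_hj_identity (n : ℕ) (hn : 2 ≤ n) (β : ℕ → ℝ) (hβ : ∀ p, 0 ≤ β p)
    (hβne : ∃ p ∈ Finset.Icc 2 n, β p ≠ 0) (N : ℕ) (hN : 1 ≤ N)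
    (P : Measure (Fin N → ℝ)) [IsProbabilityMeasure P]
    (hP : ∃ R : ℝ, P {σ | ∀ i, |σ i| ≤ R} = 1)
    (t h : ℝ) (ht : 0 < t) (hh : 0 < h) :
    ∃ Dt Dh : ℝ,
      HasDerivAt (fun t' => freeEnergy n β N P t' h) Dt t ∧
      HasDerivAt (fun h' => freeEnergy n β N P t h') Dh h ∧
      Dt - xi n β Dh
        = gibbsBracket n β N P t h (fun σ σ' => xi n β ((∑ i, σ i * σ' i) / N))
          - xi n β (gibbsBracket n β N P t h fun σ σ' => (∑ i, σ i * σ' i) / N) := by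
  obtain ⟨R, hR⟩ := hP
  have hN0 : (N : ℝ) ≠ 0 := by
    have : (0 : ℝ) < N := by exact_mod_cast hN
    exact this.ne'
  have hmeas : MeasurableSet {σ : Fin N → ℝ | ∀ i, |σ i| ≤ R} := by
    rw [Set.ofPred_forall]
    exact MeasurableSet.iInter fun i => measurableSet_le (measurable_pi_apply i).abs
      measurable_const
  have hae : ∀ᵐ σ ∂P, ∀ i, |σ i| ≤ R := (mem_ae_iff_prob_eq_one hmeas).2 hR
  obtain ⟨A, hAb⟩ := exists_forall_abs_spinCoeff_le n β N R
  have haA : ∀ᵐ σ ∂P, ∀ k, |spinCoeff n β N k σ| ≤ A := hae.mono hAb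
  have haR : ∀ᵐ σ ∂P, ∀ i : Fin N, |σ i| ≤ |R| :=
    hae.mono fun σ hσ i => (hσ i).trans (le_abs_self R)
  refine ⟨_, _, ?_, ?_, rfl⟩
  · have key := hasDerivAt_integral_log_two_fields (P := P) (b := fun i (σ : Fin N → ℝ) => σ i)
      measurable_spinCoeff (fun i => measurable_pi_apply i) haA haR (1 / (N : ℝ)) ht hh.le
    have hov : ∀ σ σ' : Fin N → ℝ, xi n β ((∑ i, σ i * σ' i) / N)
        = 1 / (N : ℝ) * ∑ k, spinCoeff n β N k σ * spinCoeff n β N k σ' := fun σ σ' => by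
      rw [sum_spinCoeff_mul hβ hN, one_div, inv_mul_cancel_left₀ hN0]
    simp only [freeEnergy, gibbsBracket, hov, enrichedH_eq_gaussExponent hβ hN, disorderZ]
    exact key
  · have key := hasDerivAt_integral_log_two_fields (P := P) (a := fun i (σ : Fin N → ℝ) => σ i)
      (fun i => measurable_pi_apply i) measurable_spinCoeff haR haA (1 / (N : ℝ)) hh ht.le
    have hov : ∀ σ σ' : Fin N → ℝ, (∑ i, σ i * σ' i) / (N : ℝ)
        = 1 / (N : ℝ) * ∑ i, σ i * σ' i := fun σ σ' => by
      rw [one_div, div_eq_inv_mul]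
    simp only [freeEnergy, gibbsBracket, hov, disorderZ]
    simp only [← integral_prod_swap (μ := Measure.pi fun _ : SpinIdx n N => gaussianReal 0 1)
      (ν := Measure.pi fun _ : Fin N => gaussianReal 0 1),
      enrichedH_eq_gaussExponent_swap hβ hN]
    exact key
end

section
/- Assume additionally that P is supported in { σ ∈ ℝ^N : |σ|² ≤ N }. Then for each m ∈ {0,…,k}, at every parameter point with 0 < q_0 < q_1 < ⋯ < q_k, the partial derivative ∂_{q_m} F(q_0,…,q_k) exists and is nonnegative. -/
open MeasureTheory ProbabilityTheory

/-- Standard Gaussian measure on `ℝ^N`. -/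
noncomputable def gaussN (N : ℕ) : Measure (Fin N → ℝ) :=
  Measure.pi fun _ => gaussianReal 0 1

/-- The innermost quantity
`X_k(y_0,…,y_k) = log ∫ exp(G(σ) + ∑_ℓ (2q_ℓ - 2q_{ℓ-1})^{1/2} y_ℓ·σ - q_k|σ|²) dP(σ)`,
with the convention `q_{-1} = 0`. -/
noncomputable def Xtop (N k : ℕ) (q : ℕ → ℝ) (P : Measure (Fin N → ℝ))
    (G : (Fin N → ℝ) → ℝ) (y : ℕ → Fin N → ℝ) : ℝ :=
  Real.log (∫ σ, Real.exp (G σ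
    + (∑ ℓ ∈ Finset.range (k + 1),
        Real.sqrt (2 * q ℓ - 2 * (if ℓ = 0 then 0 else q (ℓ - 1))) * ∑ i, y ℓ i * σ i)
    - q k * ∑ i, σ i ^ 2) ∂P)

/-- The downward recursion `X_{ℓ-1} = ζ_ℓ⁻¹ log E_{y_ℓ} exp(ζ_ℓ X_ℓ)`, reindexed so that
`cascade j = X_{k-j}`; in particular `cascade 0 = X_k` and `cascade k = X_0`. -/
noncomputable def cascade (N k : ℕ) (ζ q : ℕ → ℝ) (P : Measure (Fin N → ℝ))
    (G : (Fin N → ℝ) → ℝ) : ℕ → (ℕ → Fin N → ℝ) → ℝ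
  | 0 => Xtop N k q P G
  | j + 1 => fun y => (ζ (k - j))⁻¹ *
      Real.log (∫ z, Real.exp (ζ (k - j) *
        cascade N k ζ q P G j (Function.update y (k - j) z)) ∂(gaussN N))

/-- The free energy `F(q_0,…,q_k) = -N⁻¹ E_{y_0}[X_0(y_0)]`. -/
noncomputable def freeEnergyQ (N k : ℕ) (ζ : ℕ → ℝ) (P : Measure (Fin N → ℝ))
    (G : (Fin N → ℝ) → ℝ) (q : ℕ → ℝ) : ℝ :=
  -(1 / (N : ℝ)) * ∫ z, cascade N k ζ q P G k (fun _ => z) ∂(gaussN N)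

/-! ### Standard Gaussian vectors -/

instance isProbabilityMeasure_gaussN (N : ℕ) : IsProbabilityMeasure (gaussN N) := by
  unfold gaussN; infer_instance

theorem map_add_gaussianReal (a b : ℝ) :
    ((gaussianReal 0 1).prod (gaussianReal 0 1)).map (fun p : ℝ × ℝ => a * p.1 + b * p.2)
      = (gaussianReal 0 1).map (fun z => √(a ^ 2 + b ^ 2) * z) := by
  have h : (fun p : ℝ × ℝ => a * p.1 + b * p.2)
      = (fun p : ℝ × ℝ => p.1 + p.2) ∘ Prod.map (fun x => a * x) (fun x => b * x) := rfl
  rw [h, ← Measure.map_map (by fun_prop) (by fun_prop),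
    ← Measure.map_prod_map _ _ (by fun_prop) (by fun_prop),
    gaussianReal_map_const_mul, gaussianReal_map_const_mul, gaussianReal_map_const_mul]
  change (gaussianReal _ _) ∗ (gaussianReal _ _) = _
  rw [gaussianReal_conv_gaussianReal]
  congr 1
  · simp
  · ext
    simp [Real.sq_sqrt (add_nonneg (sq_nonneg a) (sq_nonneg b))]

theorem map_add_gaussN (N : ℕ) (a b : ℝ) :
    ((gaussN N).prod (gaussN N)).map (fun p : (Fin N → ℝ) × (Fin N → ℝ) => a • p.1 + b • p.2)
      = (gaussN N).map (fun z => √(a ^ 2 + b ^ 2) • z) := by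
  have h := measurePreserving_arrowProdEquivProdArrow ℝ ℝ (Fin N)
    (fun _ => gaussianReal 0 1) (fun _ => gaussianReal 0 1)
  unfold gaussN
  rw [← h.map_eq, Measure.map_map (by fun_prop) (MeasurableEquiv.measurable _)]
  have h1 : (fun p : (Fin N → ℝ) × (Fin N → ℝ) => a • p.1 + b • p.2)
      ∘ (MeasurableEquiv.arrowProdEquivProdArrow ℝ ℝ (Fin N))
      = fun (w : Fin N → ℝ × ℝ) i => (fun p : ℝ × ℝ => a * p.1 + b * p.2) (w i) := by
    funext w i
    rfl
  have h2 : (fun z : Fin N → ℝ => √(a ^ 2 + b ^ 2) • z)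
      = fun (z : Fin N → ℝ) i => (fun x => √(a ^ 2 + b ^ 2) * x) (z i) := by
    funext w i
    rfl
  have hm : Measurable (fun p : ℝ × ℝ => a * p.1 + b * p.2) := by fun_prop
  have hm' : Measurable (fun x : ℝ => √(a ^ 2 + b ^ 2) * x) := by fun_prop
  have := Measure.isProbabilityMeasure_map (μ := (gaussianReal 0 1).prod (gaussianReal 0 1))
    hm.aemeasurable
  have := Measure.isProbabilityMeasure_map (μ := gaussianReal 0 1) hm'.aemeasurable
  rw [h1, h2, Measure.pi_map_pi (fun _ => hm.aemeasurable),
    Measure.pi_map_pi (fun _ => hm'.aemeasurable)]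
  simp only [map_add_gaussianReal]

/-- Integrating over two independent Gaussian increments amounts to integrating over one. -/
theorem integral_integral_gaussN {N : ℕ} {h : (Fin N → ℝ) → ℝ} (hh : Continuous h) (a b : ℝ)
    (hi : Integrable (fun z => h (√(a ^ 2 + b ^ 2) • z)) (gaussN N)) :
    ∫ z, ∫ w, h (a • z + b • w) ∂(gaussN N) ∂(gaussN N)
      = ∫ z, h (√(a ^ 2 + b ^ 2) • z) ∂(gaussN N) := by
  have hm1 : AEMeasurable (fun p : (Fin N → ℝ) × (Fin N → ℝ) => a • p.1 + b • p.2)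
      ((gaussN N).prod (gaussN N)) := by fun_prop
  have hm2 : AEMeasurable (fun z : Fin N → ℝ => √(a ^ 2 + b ^ 2) • z) (gaussN N) := by fun_prop
  have hI : Integrable h ((gaussN N).map (fun z => √(a ^ 2 + b ^ 2) • z)) :=
    (integrable_map_measure hh.aestronglyMeasurable hm2).2 hi
  rw [← integral_map (f := h) hm2 hh.aestronglyMeasurable, ← map_add_gaussN,
    integral_map hm1 hh.aestronglyMeasurable]
  rw [← map_add_gaussN] at hI
  exact (integral_prod _ ((integrable_map_measure hh.aestronglyMeasurable hm1).1 hI)).symm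

theorem integrable_exp_mul_norm_gaussN (N : ℕ) (A : ℝ) :
    Integrable (fun z : Fin N → ℝ => Real.exp (A * ‖z‖)) (gaussN N) := by
  have h1 : Integrable (fun z : Fin N → ℝ => ∏ i, Real.exp (|A| * |z i|)) (gaussN N) :=
    Integrable.fintype_prod (fun _ => integrable_exp_mul_abs (X := fun x : ℝ => x)
      (integrable_exp_mul_gaussianReal _) (integrable_exp_mul_gaussianReal _))
  refine h1.mono' (by fun_prop) (Filter.Eventually.of_forall fun z => ?_)
  rw [Real.norm_eq_abs, Real.abs_exp, ← Real.exp_sum]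
  refine Real.exp_le_exp.2 ?_
  rw [← Finset.mul_sum]
  have h2 : ‖z‖ ≤ ∑ i, |z i| :=
    (pi_norm_le_iff_of_nonneg (Finset.sum_nonneg fun i _ => abs_nonneg _)).2 fun i =>
      Finset.single_le_sum (f := fun i => |z i|) (fun i _ => abs_nonneg _) (Finset.mem_univ i)
  calc A * ‖z‖ ≤ |A| * ‖z‖ := by gcongr; exact le_abs_self A
    _ ≤ _ := by gcongr

theorem integral_exp_inner_gaussN {N : ℕ} (a : ℝ) (σ : Fin N → ℝ) :
    ∫ z, Real.exp (a * ∑ i, z i * σ i) ∂(gaussN N) = Real.exp (a ^ 2 / 2 * ∑ i, σ i ^ 2) := by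
  have h : ∀ z : Fin N → ℝ, Real.exp (a * ∑ i, z i * σ i)
      = ∏ i, Real.exp ((a * σ i) * z i) := by
    intro z
    rw [← Real.exp_sum, Finset.mul_sum]
    congr 1
    exact Finset.sum_congr rfl fun i _ => by ring
  simp_rw [h]
  unfold gaussN
  rw [integral_fintype_prod_eq_prod (fun i x => Real.exp ((a * σ i) * x)), Finset.mul_sum,
    Real.exp_sum]
  refine Finset.prod_congr rfl fun i _ => ?_
  have := mgf_gaussianReal (p := gaussianReal 0 1) (X := id) (μ := 0) (v := 1)
    Measure.map_id (a * σ i)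
  simp only [mgf, id] at this
  rw [this]
  congr 1
  push_cast
  ring

/-! ### Exponential means over a Gaussian increment -/

/-- The exponential mean `ζ⁻¹ log E exp (ζ f (x + c z))` over a standard Gaussian `z`, read as
the plain mean when `ζ = 0`. -/
noncomputable def softMean {N : ℕ} (ζ c : ℝ) (f : (Fin N → ℝ) → ℝ) (x : Fin N → ℝ) : ℝ :=
  if ζ = 0 then ∫ z, f (x + c • z) ∂(gaussN N)
  else ζ⁻¹ * Real.log (∫ z, Real.exp (ζ * f (x + c • z)) ∂(gaussN N))

section softMean

variable {N : ℕ} {K K' : NNReal} {f g : (Fin N → ℝ) → ℝ}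

theorem LipschitzWith.abs_sub_le_mul_norm (hf : LipschitzWith K f) (x v : Fin N → ℝ) :
    |f (x + v) - f x| ≤ K * ‖v‖ := by
  simpa [Real.norm_eq_abs] using hf.norm_sub_le (x + v) x

theorem LipschitzWith.integrable_exp_gaussN (hf : LipschitzWith K f) (ζ c : ℝ) (x : Fin N → ℝ) :
    Integrable (fun z => Real.exp (ζ * f (x + c • z))) (gaussN N) := by
  have hc := hf.continuous
  refine ((integrable_exp_mul_norm_gaussN N (|ζ| * (K * |c|))).const_mul
    (Real.exp (ζ * f x))).mono' (by fun_prop) (Filter.Eventually.of_forall fun z => ?_)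
  rw [Real.norm_eq_abs, Real.abs_exp, ← Real.exp_add]
  refine Real.exp_le_exp.2 ?_
  have h := hf.abs_sub_le_mul_norm x (c • z)
  rw [norm_smul, Real.norm_eq_abs] at h
  have : ζ * (f (x + c • z) - f x) ≤ |ζ| * (K * (|c| * ‖z‖)) := by
    refine (le_abs_self _).trans ?_
    rw [abs_mul]
    gcongr
  linarith

theorem LipschitzWith.integrable_gaussN (hf : LipschitzWith K f) (c : ℝ) (x : Fin N → ℝ) :
    Integrable (fun z => f (x + c • z)) (gaussN N) := by
  have hc := hf.continuous
  refine ((hf.integrable_exp_gaussN 1 c x).add (hf.integrable_exp_gaussN (-1) c x)).mono'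
    (by fun_prop) (Filter.Eventually.of_forall fun z => ?_)
  rw [Real.norm_eq_abs, abs_le]
  simp only [Pi.add_apply, one_mul, neg_mul]
  have h1 := Real.add_one_le_exp (f (x + c • z))
  have h2 := Real.add_one_le_exp (-f (x + c • z))
  have h3 := Real.exp_pos (f (x + c • z))
  have h4 := Real.exp_pos (-f (x + c • z))
  constructor <;> linarith

theorem LipschitzWith.integral_exp_gaussN_pos (hf : LipschitzWith K f) (ζ c : ℝ) (x : Fin N → ℝ) :
    0 < ∫ z, Real.exp (ζ * f (x + c • z)) ∂(gaussN N) :=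
  integral_exp_pos (hf.integrable_exp_gaussN ζ c x)

theorem softMean_mono (hf : LipschitzWith K f) (hg : LipschitzWith K' g) {ζ : ℝ} (hζ : 0 ≤ ζ)
    (h : ∀ x, f x ≤ g x) (c : ℝ) (x : Fin N → ℝ) : softMean ζ c f x ≤ softMean ζ c g x := by
  unfold softMean
  split_ifs with h0
  · exact integral_mono (hf.integrable_gaussN c x) (hg.integrable_gaussN c x) fun z => h _
  · refine mul_le_mul_of_nonneg_left (Real.log_le_log (hf.integral_exp_gaussN_pos ζ c x) ?_)
      (inv_nonneg.2 hζ)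
    refine integral_mono (hf.integrable_exp_gaussN ζ c x) (hg.integrable_exp_gaussN ζ c x)
      fun z => ?_
    exact Real.exp_le_exp.2 (mul_le_mul_of_nonneg_left (h _) hζ)

theorem softMean_add_const (hf : LipschitzWith K f) (ζ c a : ℝ) (x : Fin N → ℝ) :
    softMean ζ c (fun y => f y + a) x = softMean ζ c f x + a := by
  unfold softMean
  split_ifs with h0
  · rw [integral_add (hf.integrable_gaussN c x) (integrable_const _)]
    simp
  · simp only [mul_add, Real.exp_add]
    rw [integral_mul_const, Real.log_mul (hf.integral_exp_gaussN_pos ζ c x).ne' (Real.exp_ne_zero _),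
      Real.log_exp]
    field_simp

theorem lipschitzWith_softMean (hf : LipschitzWith K f) {ζ : ℝ} (hζ : 0 ≤ ζ) (c : ℝ) :
    LipschitzWith K (softMean ζ c f) := by
  refine LipschitzWith.of_le_add_mul K fun x y => ?_
  have hs : LipschitzWith K (fun v => f (v + (x - y))) := by
    have := hf.comp (LipschitzWith.id.add (LipschitzWith.const (x - y)))
    rwa [add_zero, mul_one] at this
  have h1 : softMean ζ c f x = softMean ζ c (fun v => f (v + (x - y))) y := by
    have : ∀ z, y + c • z + (x - y) = x + c • z := fun z => by abel
    simp only [softMean, this]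
  rw [h1, ← softMean_add_const hf]
  have ha : LipschitzWith K (fun v => f v + K * dist x y) := by
    simpa using hf.add (LipschitzWith.const (K * dist x y : ℝ))
  refine softMean_mono hs ha hζ (fun v => ?_) c y
  have := hf.le_add_mul (v + (x - y)) v
  rwa [dist_eq_norm, add_sub_cancel_left, ← dist_eq_norm] at this

/-- Jensen's inequality: exponential means increase with the exponent. -/
theorem softMean_le_softMean (hf : LipschitzWith K f) {ζ ζ' : ℝ} (hζ : 0 ≤ ζ) (h : ζ < ζ') (c : ℝ)
    (x : Fin N → ℝ) : softMean ζ c f x ≤ softMean ζ' c f x := by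
  have hζ' : 0 < ζ' := hζ.trans_lt h
  rcases hζ.eq_or_lt with rfl | hpos
  · have hJ := convexOn_exp.map_integral_le (μ := gaussN N) (f := fun z => ζ' * f (x + c • z))
      Real.continuous_exp.continuousOn isClosed_univ (by simp)
      ((hf.integrable_gaussN c x).const_mul _) (hf.integrable_exp_gaussN ζ' c x)
    rw [integral_const_mul] at hJ
    have h2 := Real.log_le_log (Real.exp_pos _) hJ
    rw [Real.log_exp] at h2
    rw [softMean, softMean, if_pos rfl, if_neg hζ'.ne', ← div_eq_inv_mul, le_div_iff₀ hζ']
    linarith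
  · have hr : 1 ≤ ζ' / ζ := (one_le_div hpos).2 h.le
    have he : ∀ z, Real.exp (ζ * f (x + c • z)) ^ (ζ' / ζ) = Real.exp (ζ' * f (x + c • z)) := by
      intro z
      rw [← Real.exp_mul]
      congr 1
      field_simp
    have hJ := (convexOn_rpow hr).map_integral_le (μ := gaussN N)
      (f := fun z => Real.exp (ζ * f (x + c • z)))
      (Real.continuous_rpow_const (zero_le_one.trans hr)).continuousOn isClosed_Ici
      (Filter.Eventually.of_forall fun z => (Real.exp_pos _).le)
      (hf.integrable_exp_gaussN ζ c x)
      (by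
        refine (hf.integrable_exp_gaussN ζ' c x).congr (Filter.Eventually.of_forall fun z => ?_)
        exact (he z).symm)
    simp only [he] at hJ
    have hp := hf.integral_exp_gaussN_pos ζ c x
    have h2 := Real.log_le_log (Real.rpow_pos_of_pos hp _) hJ
    rw [Real.log_rpow hp] at h2
    rw [softMean, softMean, if_neg hpos.ne', if_neg hζ'.ne', ← div_eq_inv_mul,
      ← div_eq_inv_mul, le_div_iff₀ hζ']
    rwa [div_mul_comm]

theorem softMean_softMean (hf : LipschitzWith K f) {ζ : ℝ} (a b : ℝ) (x : Fin N → ℝ) :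
    softMean ζ a (softMean ζ b f) x = softMean ζ √(a ^ 2 + b ^ 2) f x := by
  have hc := hf.continuous
  by_cases h0 : ζ = 0
  · simp only [softMean, if_pos h0]
    rw [← integral_integral_gaussN (h := fun w => f (x + w)) (by fun_prop) a b
      (hf.integrable_gaussN _ x)]
    simp only [add_assoc]
  · simp only [softMean, if_neg h0, mul_inv_cancel_left₀ h0]
    simp only [Real.exp_log (hf.integral_exp_gaussN_pos ζ b _)]
    rw [← integral_integral_gaussN (h := fun w => Real.exp (ζ * f (x + w))) (by fun_prop) a b
      (hf.integrable_exp_gaussN ζ _ x)]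
    simp only [add_assoc]

end softMean

/-! ### Differentiation of exponential means with respect to a parameter -/

section Differentiation

open Metric Topology

variable {N : ℕ} {s₀ : ℝ}

/-- `f (s, x)` is differentiable, with a bounded derivative, for `s` near `s₀` and every `x`. -/
def BoundedFDerivNear (s₀ : ℝ) (f : ℝ × (Fin N → ℝ) → ℝ) : Prop :=
  ∃ K, ∀ᶠ s in 𝓝 s₀, ∀ x, DifferentiableAt ℝ f (s, x) ∧ ‖fderiv ℝ f (s, x)‖ ≤ K

theorem BoundedFDerivNear.exists_ball {f : ℝ × (Fin N → ℝ) → ℝ} (hf : BoundedFDerivNear s₀ f) :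
    ∃ K, 0 ≤ K ∧ ∃ ε > 0, ∀ p : ℝ × (Fin N → ℝ), p.1 ∈ ball s₀ ε →
      DifferentiableAt ℝ f p ∧ ‖fderiv ℝ f p‖ ≤ K := by
  obtain ⟨K, hK⟩ := hf
  obtain ⟨ε, hε, h⟩ := Metric.eventually_nhds_iff_ball.1 hK
  exact ⟨K, (norm_nonneg _).trans (h s₀ (mem_ball_self hε) 0).2, ε, hε, fun p hp => h p.1 hp p.2⟩

theorem abs_sub_le_of_norm_fderiv_le {f : ℝ × (Fin N → ℝ) → ℝ} {K ε : ℝ}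
    (h : ∀ p : ℝ × (Fin N → ℝ), p.1 ∈ ball s₀ ε → DifferentiableAt ℝ f p ∧ ‖fderiv ℝ f p‖ ≤ K)
    {p p' : ℝ × (Fin N → ℝ)} (hp : p.1 ∈ ball s₀ ε) (hp' : p'.1 ∈ ball s₀ ε) :
    |f p - f p'| ≤ K * ‖p - p'‖ := by
  have hconv : Convex ℝ (ball s₀ ε ×ˢ (Set.univ : Set (Fin N → ℝ))) :=
    (convex_ball _ _).prod convex_univ
  exact hconv.norm_image_sub_le_of_norm_fderiv_le (𝕜 := ℝ) (fun x hx => (h x hx.1).1)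
    (fun x hx => (h x hx.1).2) ⟨hp', trivial⟩ ⟨hp, trivial⟩

theorem BoundedFDerivNear.eventually_lipschitzWith {f : ℝ × (Fin N → ℝ) → ℝ}
    (hf : BoundedFDerivNear s₀ f) : ∀ᶠ s in 𝓝 s₀, ∃ K, LipschitzWith K (fun x => f (s, x)) := by
  obtain ⟨K, hK0, ε, hε, h⟩ := hf.exists_ball
  filter_upwards [ball_mem_nhds s₀ hε] with s hs
  refine ⟨⟨K, hK0⟩, LipschitzWith.of_dist_le_mul fun x y => ?_⟩
  have := abs_sub_le_of_norm_fderiv_le h (p := (s, x)) (p' := (s, y)) hs hs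
  rw [Real.dist_eq, dist_eq_norm]
  refine this.trans_eq ?_
  rw [Prod.mk_sub_mk, sub_self, Prod.norm_mk, norm_zero, max_eq_right (norm_nonneg _)]
  rfl

theorem differentiableAt_log_integral_exp {Ω W : Type*} [MeasurableSpace Ω] {μ : Measure Ω}
    [NeZero μ] [NormedAddCommGroup W] [NormedSpace ℝ W] {g : Ω → W → ℝ} {g' : Ω → W → W →L[ℝ] ℝ}
    {B bound : Ω → ℝ} {K : ℝ} {U : Set W} {p : W} (hU : U ∈ 𝓝 p)
    (hder : ∀ᵐ ω ∂μ, ∀ p ∈ U, HasFDerivAt (g ω) (g' ω p) p ∧ ‖g' ω p‖ ≤ B ω)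
    (hg : ∀ p ∈ U, AEStronglyMeasurable (fun ω => g ω p) μ)
    (hg' : AEStronglyMeasurable (fun ω => g' ω p) μ)
    (hB : AEStronglyMeasurable B μ)
    (hbound : ∀ᵐ ω ∂μ, ∀ p ∈ U, Real.exp (g ω p) ≤ bound ω)
    (hi : Integrable bound μ) (hBi : Integrable (fun ω => B ω * bound ω) μ)
    (hK : ∫ ω, B ω * Real.exp (g ω p) ∂μ ≤ K * ∫ ω, Real.exp (g ω p) ∂μ) :
    DifferentiableAt ℝ (fun p => Real.log (∫ ω, Real.exp (g ω p) ∂μ)) p ∧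
      ‖fderiv ℝ (fun p => Real.log (∫ ω, Real.exp (g ω p) ∂μ)) p‖ ≤ K := by
  have hp : p ∈ U := mem_of_mem_nhds hU
  have hme : ∀ p ∈ U, AEStronglyMeasurable (fun ω => Real.exp (g ω p)) μ := fun p hp =>
    Real.continuous_exp.comp_aestronglyMeasurable (hg p hp)
  have hexp_int : Integrable (fun ω => Real.exp (g ω p)) μ := by
    refine hi.mono' (hme p hp) ?_
    filter_upwards [hbound] with ω hω
    rw [Real.norm_eq_abs, Real.abs_exp]
    exact hω p hp
  have hBExp_int : Integrable (fun ω => B ω * Real.exp (g ω p)) μ := by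
    refine hBi.mono' (hB.mul (hme p hp)) ?_
    filter_upwards [hbound, hder] with ω hω hω'
    have hB0 : 0 ≤ B ω := (norm_nonneg _).trans (hω' p hp).2
    rw [norm_mul, Real.norm_eq_abs, Real.norm_eq_abs, Real.abs_exp, abs_of_nonneg hB0]
    exact mul_le_mul_of_nonneg_left (hω p hp) hB0
  have hD : HasFDerivAt (fun p => ∫ ω, Real.exp (g ω p) ∂μ)
      (∫ ω, Real.exp (g ω p) • g' ω p ∂μ) p := by
    refine hasFDerivAt_integral_of_dominated_of_fderiv_le
      (F' := fun p ω => Real.exp (g ω p) • g' ω p) (bound := fun ω => B ω * bound ω) hU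
      (Filter.eventually_of_mem hU hme) hexp_int ((hme p hp).smul hg') ?_ hBi ?_
    · filter_upwards [hbound, hder] with ω hω hω' q hq
      rw [norm_smul, Real.norm_eq_abs, Real.abs_exp, mul_comm]
      have hB0 : 0 ≤ B ω := (norm_nonneg _).trans (hω' q hq).2
      exact mul_le_mul (hω' q hq).2 (hω q hq) (Real.exp_pos _).le hB0
    · filter_upwards [hder] with ω hω q hq
      exact (hω q hq).1.exp
  have hpos : 0 < ∫ ω, Real.exp (g ω p) ∂μ := integral_exp_pos hexp_int
  have hL := hD.log hpos.ne'
  refine ⟨hL.differentiableAt, ?_⟩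
  rw [hL.fderiv, norm_smul, norm_inv, Real.norm_of_nonneg hpos.le, inv_mul_le_iff₀ hpos, mul_comm]
  refine le_trans ?_ hK
  refine norm_integral_le_of_norm_le hBExp_int ?_
  filter_upwards [hder] with ω hω
  rw [norm_smul, Real.norm_eq_abs, Real.abs_exp, mul_comm]
  exact mul_le_mul_of_nonneg_right (hω p hp).2 (Real.exp_pos _).le

theorem ContDiffAt.exists_ball_bound {c : ℝ → ℝ} (hc : ContDiffAt ℝ 1 c s₀) :
    ∃ D, 0 ≤ D ∧ ∃ ε > 0, ∀ s ∈ ball s₀ ε,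
      DifferentiableAt ℝ c s ∧ |c s| ≤ D ∧ |deriv c s| ≤ D := by
  have h1 : ∀ᶠ s in 𝓝 s₀, DifferentiableAt ℝ c s :=
    (hc.eventually (by simp)).mono fun s hs => hs.differentiableAt one_ne_zero
  have h2 : ∀ᶠ s in 𝓝 s₀, |c s| < |c s₀| + 1 :=
    hc.continuousAt.abs.eventually_lt_const (lt_add_one _)
  have hd : ContinuousAt (deriv c) s₀ := by
    have : ContinuousAt (fun s => fderiv ℝ c s 1) s₀ :=
      (hc.continuousAt_fderiv one_ne_zero).clm_apply continuousAt_const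
    simpa only [fderiv_apply_one_eq_deriv] using this
  have h3 : ∀ᶠ s in 𝓝 s₀, |deriv c s| < |deriv c s₀| + 1 :=
    hd.abs.eventually_lt_const (lt_add_one _)
  obtain ⟨ε, hε, h⟩ := Metric.eventually_nhds_iff_ball.1 (h1.and (h2.and h3))
  refine ⟨max (|c s₀| + 1) (|deriv c s₀| + 1), le_max_of_le_left (by positivity), ε, hε,
    fun s hs => ⟨(h s hs).1, ?_, ?_⟩⟩
  · exact (h s hs).2.1.le.trans (le_max_left _ _)
  · exact (h s hs).2.2.le.trans (le_max_right _ _)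

/-- The derivative of `(s, x) ↦ f (s, x + c s • z)`. -/
noncomputable def fderivShift (f : ℝ × (Fin N → ℝ) → ℝ) (c : ℝ → ℝ) (z : Fin N → ℝ)
    (p : ℝ × (Fin N → ℝ)) : ℝ × (Fin N → ℝ) →L[ℝ] ℝ :=
  (fderiv ℝ f (p.1, p.2 + c p.1 • z)).comp
    ((ContinuousLinearMap.fst ℝ ℝ (Fin N → ℝ)).prod
      (ContinuousLinearMap.snd ℝ ℝ (Fin N → ℝ)
        + (ContinuousLinearMap.fst ℝ ℝ (Fin N → ℝ)).smulRight (deriv c p.1 • z)))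

theorem measurable_fderivShift (f : ℝ × (Fin N → ℝ) → ℝ) (c : ℝ → ℝ) (p : ℝ × (Fin N → ℝ)) :
    Measurable (fun z => fderivShift f c z p) := by
  have h1 : Measurable (fun z : Fin N → ℝ => fderiv ℝ f (p.1, p.2 + c p.1 • z)) :=
    (measurable_fderiv ℝ f).comp (by fun_prop)
  have h2 : Continuous fun z : Fin N → ℝ =>
      ((ContinuousLinearMap.fst ℝ ℝ (Fin N → ℝ)).prod
      (ContinuousLinearMap.snd ℝ ℝ (Fin N → ℝ)
        + (ContinuousLinearMap.fst ℝ ℝ (Fin N → ℝ)).smulRight (deriv c p.1 • z))) := by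
    have h3 : Continuous fun z : Fin N → ℝ =>
        (ContinuousLinearMap.fst ℝ ℝ (Fin N → ℝ)).smulRight (deriv c p.1 • z) :=
      (ContinuousLinearMap.smulRightL ℝ (ℝ × (Fin N → ℝ)) (Fin N → ℝ)
        (ContinuousLinearMap.fst ℝ ℝ (Fin N → ℝ))).continuous.comp (by fun_prop)
    exact (ContinuousLinearMap.prodₗᵢ ℝ).continuous.comp
      (continuous_const.prodMk (continuous_const.add h3))
  exact isBoundedBilinearMap_comp.continuous.measurable.comp (h1.prodMk h2.measurable)

section Shift

variable {f : ℝ × (Fin N → ℝ) → ℝ} {c : ℝ → ℝ} {K D ε : ℝ}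

theorem hasFDerivAt_shift {p : ℝ × (Fin N → ℝ)} {z : Fin N → ℝ}
    (hf : DifferentiableAt ℝ f (p.1, p.2 + c p.1 • z)) (hc : DifferentiableAt ℝ c p.1) :
    HasFDerivAt (fun p : ℝ × (Fin N → ℝ) => f (p.1, p.2 + c p.1 • z)) (fderivShift f c z p) p := by
  have h1 : HasFDerivAt (fun p : ℝ × (Fin N → ℝ) => c p.1 • z)
      ((ContinuousLinearMap.fst ℝ ℝ (Fin N → ℝ)).smulRight (deriv c p.1 • z)) p := by
    have := (hc.hasDerivAt.comp_hasFDerivAt p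
      (hasFDerivAt_fst (𝕜 := ℝ) (E := ℝ) (F := Fin N → ℝ))).smul_const z
    refine this.congr_fderiv ?_
    ext v <;> simp [mul_comm]
  exact hf.hasFDerivAt.comp p (hasFDerivAt_fst.prodMk (hasFDerivAt_snd.add h1))

theorem norm_fderivShift_le {p : ℝ × (Fin N → ℝ)} {z : Fin N → ℝ} (hK0 : 0 ≤ K) (hD0 : 0 ≤ D)
    (hf : ‖fderiv ℝ f (p.1, p.2 + c p.1 • z)‖ ≤ K) (hc : |deriv c p.1| ≤ D) :
    ‖fderivShift f c z p‖ ≤ K * Real.exp (D * ‖z‖) := by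
  refine (ContinuousLinearMap.opNorm_comp_le _ _).trans ?_
  refine mul_le_mul hf ?_ (norm_nonneg _) hK0
  refine ContinuousLinearMap.opNorm_le_bound _ (Real.exp_pos _).le fun v => ?_
  have h1 : ‖v.1‖ ≤ ‖v‖ := norm_fst_le v
  have h2 : ‖v.2‖ ≤ ‖v‖ := norm_snd_le v
  have h3 : 1 + D * ‖z‖ ≤ Real.exp (D * ‖z‖) := by
    linarith [Real.add_one_le_exp (D * ‖z‖)]
  have h4 : (1 + D * ‖z‖) * ‖v‖ ≤ Real.exp (D * ‖z‖) * ‖v‖ := by gcongr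
  have h5 : 0 ≤ D * ‖z‖ * ‖v‖ := by positivity
  refine le_trans ?_ h4
  rw [Prod.norm_def]
  refine max_le ?_ ?_
  · change ‖v.1‖ ≤ _
    linarith
  · change ‖v.2 + v.1 • (deriv c p.1 • z)‖ ≤ _
    refine (norm_add_le _ _).trans ?_
    rw [norm_smul, norm_smul, Real.norm_eq_abs (deriv c p.1)]
    have : ‖v.1‖ * (|deriv c p.1| * ‖z‖) ≤ ‖v‖ * (D * ‖z‖) := by gcongr
    linarith

theorem abs_shift_sub_le {p p₀ : ℝ × (Fin N → ℝ)} (z : Fin N → ℝ) (hK0 : 0 ≤ K)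
    (hf : ∀ p : ℝ × (Fin N → ℝ), p.1 ∈ ball s₀ ε → DifferentiableAt ℝ f p ∧ ‖fderiv ℝ f p‖ ≤ K)
    (hc : |c p.1| ≤ D) (hp : p.1 ∈ ball s₀ ε) (hp₀ : p₀.1 ∈ ball s₀ ε) :
    |f (p.1, p.2 + c p.1 • z) - f p₀| ≤ K * (‖p - p₀‖ + D * ‖z‖) := by
  refine (abs_sub_le_of_norm_fderiv_le hf (p := (p.1, p.2 + c p.1 • z)) hp hp₀).trans ?_
  have h0 : 0 ≤ D * ‖z‖ := mul_nonneg ((abs_nonneg _).trans hc) (norm_nonneg _)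
  gcongr
  have h1 : ‖p.1 - p₀.1‖ ≤ ‖p - p₀‖ := norm_fst_le (p - p₀)
  have h2 : ‖p.2 - p₀.2‖ ≤ ‖p - p₀‖ := norm_snd_le (p - p₀)
  rw [Prod.norm_def]
  refine max_le ?_ ?_
  · change ‖p.1 - p₀.1‖ ≤ _
    linarith
  · change ‖p.2 + c p.1 • z - p₀.2‖ ≤ _
    rw [add_sub_right_comm]
    refine (norm_add_le _ _).trans (add_le_add h2 ?_)
    rw [norm_smul, Real.norm_eq_abs]
    gcongr

end Shift

theorem BoundedFDerivNear.softMean {f : ℝ → (Fin N → ℝ) → ℝ} {c : ℝ → ℝ} {ζ : ℝ} (hζ : 0 ≤ ζ)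
    (hf : BoundedFDerivNear s₀ (fun p => f p.1 p.2)) (hc : ContDiffAt ℝ 1 c s₀) :
    BoundedFDerivNear s₀ (fun p => softMean ζ (c p.1) (f p.1) p.2) := by
  obtain ⟨K, hK0, ε₁, hε₁, hf⟩ := hf.exists_ball
  obtain ⟨D, hD0, ε₂, hε₂, hc⟩ := hc.exists_ball_bound
  obtain ⟨ε, hε, hε₁', hε₂'⟩ : ∃ ε > 0, ε ≤ ε₁ ∧ ε ≤ ε₂ :=
    ⟨min ε₁ ε₂, lt_min hε₁ hε₂, min_le_left _ _, min_le_right _ _⟩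
  replace hf := fun p hp => hf p (ball_subset_ball hε₁' hp)
  replace hc := fun s hs => hc s (ball_subset_ball hε₂' hs)
  set φ : ℝ × (Fin N → ℝ) → ℝ := fun p => f p.1 p.2
  have hfc : ∀ s ∈ ball s₀ ε, Continuous (fun x => φ (s, x)) := fun s hs =>
    continuous_iff_continuousAt.2 fun x =>
      ((hf (s, x) hs).1.continuousAt).comp (f := fun x : Fin N → ℝ => (s, x)) (by fun_prop)
  have hm : ∀ p : ℝ × (Fin N → ℝ), p.1 ∈ ball s₀ ε →
      Continuous (fun z => φ (p.1, p.2 + c p.1 • z)) := fun p hp =>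
    (hfc p.1 hp).comp (by fun_prop : Continuous fun z : Fin N → ℝ => p.2 + c p.1 • z)
  have hder : ∀ p : ℝ × (Fin N → ℝ), p.1 ∈ ball s₀ ε → ∀ z,
      HasFDerivAt (fun p : ℝ × (Fin N → ℝ) => φ (p.1, p.2 + c p.1 • z)) (fderivShift φ c z p) p ∧
        ‖fderivShift φ c z p‖ ≤ K * Real.exp (D * ‖z‖) := fun p hp z =>
    ⟨hasFDerivAt_shift (hf (p.1, p.2 + c p.1 • z) hp).1 (hc p.1 hp).1,
      norm_fderivShift_le hK0 hD0 (hf (p.1, p.2 + c p.1 • z) hp).2 (hc p.1 hp).2.2⟩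
  have hU : ∀ p : ℝ × (Fin N → ℝ), p.1 ∈ ball s₀ ε →
      {p' : ℝ × (Fin N → ℝ) | p'.1 ∈ ball s₀ ε ∧ p' ∈ ball p 1} ∈ 𝓝 p := fun p hp =>
    Filter.inter_mem (continuous_fst.continuousAt.preimage_mem_nhds (isOpen_ball.mem_nhds hp))
      (ball_mem_nhds p one_pos)
  have hnear : ∀ p p₀ : ℝ × (Fin N → ℝ), p.1 ∈ ball s₀ ε → p₀.1 ∈ ball s₀ ε → ∀ z,
      |φ (p.1, p.2 + c p.1 • z) - φ p₀| ≤ K * (‖p - p₀‖ + D * ‖z‖) := fun p p₀ hp hp₀ z =>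
    abs_shift_sub_le z hK0 hf (hc p.1 hp).2.1 hp hp₀
  have hJ := integrable_exp_mul_norm_gaussN N
  by_cases h0 : ζ = 0
  · refine ⟨∫ z, K * Real.exp (D * ‖z‖) ∂(gaussN N), ?_⟩
    filter_upwards [ball_mem_nhds s₀ hε] with s hs x
    have hp : (s, x).1 ∈ ball s₀ ε := hs
    generalize (s, x) = p at hp
    have hD : HasFDerivAt (fun p : ℝ × (Fin N → ℝ) => ∫ z, φ (p.1, p.2 + c p.1 • z) ∂(gaussN N))
        (∫ z, fderivShift φ c z p ∂(gaussN N)) p := by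
      refine hasFDerivAt_integral_of_dominated_of_fderiv_le
        (F := fun p z => φ (p.1, p.2 + c p.1 • z)) (F' := fun p z => fderivShift φ c z p)
        (bound := fun z => K * Real.exp (D * ‖z‖)) (hU p hp) ?_ ?_ ?_ ?_ ((hJ D).const_mul K) ?_
      · exact Filter.eventually_of_mem (hU p hp) fun q hq => (hm q hq.1).aestronglyMeasurable
      · refine ((integrable_const |φ p|).add ((hJ D).const_mul K)).mono'
          (hm p hp).aestronglyMeasurable (Filter.Eventually.of_forall fun z => ?_)
        have h1 := hnear p p hp hp z
        rw [sub_self, norm_zero, zero_add] at h1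
        have h2 : D * ‖z‖ ≤ Real.exp (D * ‖z‖) := by linarith [Real.add_one_le_exp (D * ‖z‖)]
        have h3 := mul_le_mul_of_nonneg_left h2 hK0
        have h4 := abs_sub_abs_le_abs_sub (φ (p.1, p.2 + c p.1 • z)) (φ p)
        rw [Real.norm_eq_abs]
        simp only [Pi.add_apply]
        linarith
      · exact (measurable_fderivShift φ c p).aestronglyMeasurable
      · exact Filter.Eventually.of_forall fun z q hq => (hder q hq.1 z).2
      · exact Filter.Eventually.of_forall fun z q hq => (hder q hq.1 z).1
    simp only [_root_.softMean, if_pos h0]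
    refine ⟨hD.differentiableAt, ?_⟩
    rw [hD.fderiv]
    exact norm_integral_le_of_norm_le ((hJ D).const_mul K)
      (Filter.Eventually.of_forall fun z => (hder p hp z).2)
  · set J₁ := ∫ z : Fin N → ℝ, Real.exp ((D + ζ * K * D) * ‖z‖) ∂(gaussN N) with hJ₁
    set J₂ := ∫ z : Fin N → ℝ, Real.exp (-(ζ * K * D) * ‖z‖) ∂(gaussN N) with hJ₂
    have hJ₂pos : 0 < J₂ := integral_exp_pos (hJ _)
    refine ⟨ζ⁻¹ * (ζ * K * (J₁ / J₂)), ?_⟩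
    filter_upwards [ball_mem_nhds s₀ hε] with s hs x
    have hp : (s, x).1 ∈ ball s₀ ε := hs
    generalize (s, x) = p at hp
    have hpp : ∀ z, |φ (p.1, p.2 + c p.1 • z) - φ p| ≤ K * D * ‖z‖ := fun z => by
      have h1 := hnear p p hp hp z
      rwa [sub_self, norm_zero, zero_add, ← mul_assoc] at h1
    have hi : Integrable (fun z => Real.exp (ζ * φ (p.1, p.2 + c p.1 • z))) (gaussN N) := by
      refine ((hJ (ζ * K * D)).const_mul (Real.exp (ζ * φ p))).mono'
        (Real.continuous_exp.comp (continuous_const.mul (hm p hp))).aestronglyMeasurable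
        (Filter.Eventually.of_forall fun z => ?_)
      rw [Real.norm_eq_abs, Real.abs_exp, ← Real.exp_add]
      refine Real.exp_le_exp.2 ?_
      have h2 := mul_le_mul_of_nonneg_left (abs_le.1 (hpp z)).2 hζ
      linarith
    have hlow : Real.exp (ζ * φ p) * J₂ ≤
        ∫ z, Real.exp (ζ * φ (p.1, p.2 + c p.1 • z)) ∂(gaussN N) := by
      rw [hJ₂, ← integral_const_mul]
      refine integral_mono ((hJ _).const_mul _) hi fun z => ?_
      simp only [← Real.exp_add]
      refine Real.exp_le_exp.2 ?_
      have h2 := mul_le_mul_of_nonneg_left (abs_le.1 (hpp z)).1 hζ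
      linarith
    have hup : ∫ z, ζ * (K * Real.exp (D * ‖z‖)) * Real.exp (ζ * φ (p.1, p.2 + c p.1 • z))
        ∂(gaussN N) ≤ ζ * K * Real.exp (ζ * φ p) * J₁ := by
      rw [hJ₁, ← integral_const_mul]
      refine integral_mono_of_nonneg (Filter.Eventually.of_forall fun z => by positivity)
        ((hJ _).const_mul _) (Filter.Eventually.of_forall fun z => ?_)
      have h3 : Real.exp (D * ‖z‖) * Real.exp (ζ * φ (p.1, p.2 + c p.1 • z))
          ≤ Real.exp (ζ * φ p) * Real.exp ((D + ζ * K * D) * ‖z‖) := by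
        rw [← Real.exp_add, ← Real.exp_add]
        refine Real.exp_le_exp.2 ?_
        have h2 := mul_le_mul_of_nonneg_left (abs_le.1 (hpp z)).2 hζ
        linarith
      have h4 := mul_le_mul_of_nonneg_left h3 (mul_nonneg hζ hK0)
      calc _ = ζ * K * (Real.exp (D * ‖z‖) * Real.exp (ζ * φ (p.1, p.2 + c p.1 • z))) := by ring
        _ ≤ _ := h4
        _ = _ := by ring
    have hmain := differentiableAt_log_integral_exp (μ := gaussN N)
      (g := fun z p => ζ * φ (p.1, p.2 + c p.1 • z)) (g' := fun z p => ζ • fderivShift φ c z p)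
      (B := fun z => ζ * (K * Real.exp (D * ‖z‖)))
      (bound := fun z => Real.exp (ζ * φ p + ζ * K) * Real.exp (ζ * K * D * ‖z‖))
      (K := ζ * K * (J₁ / J₂)) (hU p hp)
      (Filter.Eventually.of_forall fun z q hq => ⟨(hder q hq.1 z).1.const_mul ζ, by
        rw [norm_smul, Real.norm_of_nonneg hζ]
        exact mul_le_mul_of_nonneg_left (hder q hq.1 z).2 hζ⟩)
      (fun q hq => (continuous_const.mul (hm q hq.1)).aestronglyMeasurable)
      ((measurable_fderivShift φ c p).aestronglyMeasurable.const_smul ζ)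
      (by fun_prop)
      (Filter.Eventually.of_forall fun z q hq => by
        rw [← Real.exp_add]
        refine Real.exp_le_exp.2 ?_
        have h1 := (abs_le.1 (hnear q p hq.1 hp z)).2
        have h2 : ‖q - p‖ ≤ 1 := (mem_ball_iff_norm.1 hq.2).le
        have h3 : K * (‖q - p‖ + D * ‖z‖) ≤ K * (1 + D * ‖z‖) := by gcongr
        have h4 := mul_le_mul_of_nonneg_left (h1.trans h3) hζ
        linarith)
      ((hJ _).const_mul _)
      (by
        refine ((hJ (D + ζ * K * D)).const_mul (ζ * K * Real.exp (ζ * φ p + ζ * K))).congr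
          (Filter.Eventually.of_forall fun z => ?_)
        simp only [add_mul D, Real.exp_add]
        ring)
      (by
        refine hup.trans ?_
        have h5 := mul_le_mul_of_nonneg_left hlow
          (mul_nonneg (mul_nonneg hζ hK0) (div_nonneg (integral_nonneg fun z =>
            (Real.exp_pos ((D + ζ * K * D) * ‖z‖)).le) hJ₂pos.le) :
            0 ≤ ζ * K * (J₁ / J₂))
        refine le_trans (le_of_eq ?_) h5
        field_simp)
    simp only [_root_.softMean, if_neg h0]
    have hmain1 := hmain.1.hasFDerivAt.const_mul ζ⁻¹
    refine ⟨hmain1.differentiableAt, ?_⟩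
    rw [hmain1.fderiv, norm_smul, norm_inv, Real.norm_of_nonneg hζ]
    exact mul_le_mul_of_nonneg_left hmain.2 (inv_nonneg.2 hζ)

end Differentiation

/-! ### The cascade as iterated exponential means -/

section Cascade

open Topology

variable {N k : ℕ} {ζ q : ℕ → ℝ} {P : Measure (Fin N → ℝ)} {G : (Fin N → ℝ) → ℝ}

/-- The log-partition function in the external field `x` with self-overlap penalty `b`. -/
noncomputable def logPartition (P : Measure (Fin N → ℝ)) (G : (Fin N → ℝ) → ℝ) (b : ℝ)
    (x : Fin N → ℝ) : ℝ :=
  Real.log (∫ σ, Real.exp (G σ + ∑ i, x i * σ i - b * ∑ i, σ i ^ 2) ∂P)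

/-- The standard deviation of the `ℓ`-th Gaussian increment. -/
noncomputable def increment (q : ℕ → ℝ) (ℓ : ℕ) : ℝ :=
  √(2 * q ℓ - 2 * (if ℓ = 0 then 0 else q (ℓ - 1)))

/-- The cascade as a function of the total Gaussian field. -/
noncomputable def fieldCascade (N k : ℕ) (ζ q : ℕ → ℝ) (P : Measure (Fin N → ℝ))
    (G : (Fin N → ℝ) → ℝ) : ℕ → (Fin N → ℝ) → ℝ
  | 0 => logPartition P G (q k)
  | j + 1 => softMean (ζ (k - j)) (increment q (k - j)) (fieldCascade N k ζ q P G j)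

theorem cascade_eq_fieldCascade (hζ : ∀ ℓ, 1 ≤ ℓ → ℓ ≤ k → ζ ℓ ≠ 0) :
    ∀ j ≤ k, ∀ y : ℕ → Fin N → ℝ, cascade N k ζ q P G j y
      = fieldCascade N k ζ q P G j (∑ ℓ ∈ Finset.range (k - j + 1), increment q ℓ • y ℓ)
  | 0, _, y => by
    simp only [cascade, Xtop, fieldCascade, logPartition]
    congr 3
    funext σ
    congr 3
    simp only [tsub_zero, Finset.sum_apply, Pi.smul_apply, smul_eq_mul, Finset.sum_mul,
      Finset.mul_sum, increment]
    rw [Finset.sum_comm]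
    simp only [mul_assoc]
  | j + 1, hj, y => by
    have hsum : ∀ z, ∑ ℓ ∈ Finset.range (k - j + 1),
        increment q ℓ • Function.update y (k - j) z ℓ
        = ∑ ℓ ∈ Finset.range (k - (j + 1) + 1), increment q ℓ • y ℓ
          + increment q (k - j) • z := by
      intro z
      rw [Finset.sum_range_succ, Function.update_self, show k - (j + 1) + 1 = k - j by omega]
      congr 1
      refine Finset.sum_congr rfl fun ℓ hℓ => ?_
      rw [Function.update_of_ne (Finset.mem_range.1 hℓ).ne]
    rw [cascade, fieldCascade, softMean, if_neg (hζ _ (by omega) (by omega))]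
    simp only [cascade_eq_fieldCascade hζ j (by omega), hsum]

theorem freeEnergyQ_eq_fieldCascade (hζ0 : ζ 0 = 0) (hζ : ∀ ℓ, 1 ≤ ℓ → ℓ ≤ k → ζ ℓ ≠ 0) :
    freeEnergyQ N k ζ P G q = -(1 / (N : ℝ)) * fieldCascade N k ζ q P G (k + 1) 0 := by
  simp [freeEnergyQ, cascade_eq_fieldCascade hζ k le_rfl, fieldCascade, softMean, hζ0]

section LogPartition

variable {C : ℝ}

theorem abs_sum_mul_le_s15 {σ : Fin N → ℝ} (hσ : ∑ i, σ i ^ 2 ≤ N) (x : Fin N → ℝ) :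
    |∑ i, x i * σ i| ≤ (N : ℝ) * N * ‖x‖ := by
  have h1 : ∀ i, |x i * σ i| ≤ ‖x‖ * N := fun i => by
    rw [abs_mul]
    refine mul_le_mul (norm_le_pi_norm x i) ?_ (abs_nonneg _) (norm_nonneg _)
    refine abs_le_of_sq_le_sq ?_ (Nat.cast_nonneg N)
    have h2 : σ i ^ 2 ≤ ∑ i, σ i ^ 2 :=
      Finset.single_le_sum (f := fun i => σ i ^ 2) (fun i _ => sq_nonneg _) (Finset.mem_univ i)
    have h3 : (N : ℝ) ≤ (N : ℝ) ^ 2 := by exact_mod_cast Nat.le_self_pow two_ne_zero N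
    linarith
  calc |∑ i, x i * σ i| ≤ ∑ i, |x i * σ i| := Finset.abs_sum_le_sum_abs _ _
    _ ≤ ∑ _i : Fin N, ‖x‖ * N := Finset.sum_le_sum fun i _ => h1 i
    _ = _ := by simp; ring

theorem abs_hamiltonian_le (hG : ∀ σ, |G σ| ≤ C) {σ : Fin N → ℝ} (hσ : ∑ i, σ i ^ 2 ≤ N)
    (x : Fin N → ℝ) (b : ℝ) :
    |G σ + ∑ i, x i * σ i - b * ∑ i, σ i ^ 2| ≤ C + (N : ℝ) * N * ‖x‖ + |b| * N := by
  have h0 : 0 ≤ ∑ i, σ i ^ 2 := Finset.sum_nonneg fun i _ => sq_nonneg _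
  refine (abs_sub _ _).trans (add_le_add ((abs_add_le _ _).trans
    (add_le_add (hG σ) (abs_sum_mul_le_s15 hσ x))) ?_)
  rw [abs_mul, abs_of_nonneg h0]
  gcongr

variable [IsProbabilityMeasure P]

theorem integrable_exp_hamiltonian (hP : ∀ᵐ σ ∂P, ∑ i, σ i ^ 2 ≤ (N : ℝ)) (hGm : Measurable G)
    (hG : ∀ σ, |G σ| ≤ C) (x : Fin N → ℝ) (b : ℝ) :
    Integrable (fun σ => Real.exp (G σ + ∑ i, x i * σ i - b * ∑ i, σ i ^ 2)) P := by
  refine (integrable_const (Real.exp (C + (N : ℝ) * N * ‖x‖ + |b| * N))).mono'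
    (by fun_prop) ?_
  filter_upwards [hP] with σ hσ
  rw [Real.norm_eq_abs, Real.abs_exp]
  exact Real.exp_le_exp.2 (abs_le.1 (abs_hamiltonian_le hG hσ x b)).2

/-- A Gaussian increment with exponent `1` compensates a change of the self-overlap penalty. -/
theorem softMean_one_logPartition (hP : ∀ᵐ σ ∂P, ∑ i, σ i ^ 2 ≤ (N : ℝ)) (hGm : Measurable G)
    (hG : ∀ σ, |G σ| ≤ C) {s t : ℝ} (hst : s ≤ t) :
    softMean 1 √(2 * (t - s)) (logPartition P G t) = logPartition P G s := by
  funext x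
  set c := √(2 * (t - s)) with hc
  have hc2 : c ^ 2 / 2 = t - s := by rw [hc, Real.sq_sqrt (by linarith)]; ring
  have hpos : ∀ (y : Fin N → ℝ) (b : ℝ), 0 < ∫ σ, Real.exp (G σ + ∑ i, y i * σ i - b * ∑ i, σ i ^ 2) ∂P := fun y b =>
    integral_exp_pos (integrable_exp_hamiltonian hP hGm hG y b)
  rw [softMean, if_neg one_ne_zero, inv_one, one_mul]
  simp only [one_mul, logPartition, Real.exp_log (hpos _ _)]
  congr 1
  rw [integral_integral_swap]
  · refine integral_congr_ae (Filter.Eventually.of_forall fun σ => ?_)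
    have h1 : ∀ z : Fin N → ℝ,
        Real.exp (G σ + ∑ i, (x + c • z) i * σ i - t * ∑ i, σ i ^ 2)
          = Real.exp (G σ + ∑ i, x i * σ i - t * ∑ i, σ i ^ 2)
            * Real.exp (c * ∑ i, z i * σ i) := fun z => by
      rw [← Real.exp_add]
      congr 1
      simp only [Pi.add_apply, Pi.smul_apply, smul_eq_mul, add_mul, Finset.sum_add_distrib,
        Finset.mul_sum, mul_assoc]
      ring
    simp only [h1]
    rw [integral_const_mul, integral_exp_inner_gaussN, ← Real.exp_add, hc2]
    congr 1
    ring
  · have hb : Integrable (fun z : Fin N → ℝ =>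
        Real.exp (C + (N : ℝ) * N * ‖x‖ + |t| * N) * Real.exp ((N : ℝ) * N * |c| * ‖z‖))
        (gaussN N) := (integrable_exp_mul_norm_gaussN N _).const_mul _
    refine (hb.comp_fst P).mono' ?_ ?_
    · refine Measurable.aestronglyMeasurable ?_
      simp only [Function.uncurry_def]
      fun_prop
    · have h2 : ∀ᵐ p : (Fin N → ℝ) × (Fin N → ℝ) ∂((gaussN N).prod P),
          ∑ i, p.2 i ^ 2 ≤ (N : ℝ) := Measure.quasiMeasurePreserving_snd.ae hP
      filter_upwards [h2] with p hp
      rw [Function.uncurry_def, Real.norm_eq_abs, Real.abs_exp, ← Real.exp_add]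
      refine Real.exp_le_exp.2 ?_
      have h3 := (abs_le.1 (abs_hamiltonian_le hG hp (x + c • p.1) t)).2
      have h4 : (N : ℝ) * N * ‖x + c • p.1‖ ≤ (N : ℝ) * N * (‖x‖ + |c| * ‖p.1‖) := by
        gcongr
        refine (norm_add_le _ _).trans_eq ?_
        rw [norm_smul, Real.norm_eq_abs]
      linarith

/-- The field `x ↦ ∑ i, x i * σ i` as a continuous linear functional of `(s, x)`. -/
noncomputable def fieldCLM (σ : Fin N → ℝ) : ℝ × (Fin N → ℝ) →L[ℝ] ℝ :=
  (∑ i, σ i • ContinuousLinearMap.proj (R := ℝ) (φ := fun _ : Fin N => ℝ) i).comp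
    (ContinuousLinearMap.snd ℝ ℝ (Fin N → ℝ))

theorem fieldCLM_apply (σ : Fin N → ℝ) (p : ℝ × (Fin N → ℝ)) :
    fieldCLM σ p = ∑ i, p.2 i * σ i := by
  simp [fieldCLM, mul_comm]

theorem continuous_fieldCLM : Continuous (fieldCLM (N := N)) := by
  unfold fieldCLM
  fun_prop

theorem boundedFDerivNear_logPartition (hP : ∀ᵐ σ ∂P, ∑ i, σ i ^ 2 ≤ (N : ℝ))
    (hGm : Measurable G) (hG : ∀ σ, |G σ| ≤ C) {s₀ : ℝ} {κ : ℝ → ℝ} (hκ : ContDiffAt ℝ 1 κ s₀) :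
    BoundedFDerivNear s₀ (fun p : ℝ × (Fin N → ℝ) => logPartition P G (κ p.1) p.2) := by
  obtain ⟨D, hD0, ε, hε, hκ⟩ := hκ.exists_ball_bound
  refine ⟨(N : ℝ) * N + D * N, ?_⟩
  filter_upwards [Metric.ball_mem_nhds s₀ hε] with s hs x
  have hp : (s, x).1 ∈ Metric.ball s₀ ε := hs
  generalize (s, x) = p at hp
  have hU : {p' : ℝ × (Fin N → ℝ) | p'.1 ∈ Metric.ball s₀ ε ∧ p' ∈ Metric.ball p 1} ∈ 𝓝 p :=
    Filter.inter_mem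
      (continuous_fst.continuousAt.preimage_mem_nhds (Metric.isOpen_ball.mem_nhds hp))
      (Metric.ball_mem_nhds p one_pos)
  refine differentiableAt_log_integral_exp (μ := P)
    (g := fun σ p => G σ + ∑ i, p.2 i * σ i - κ p.1 * ∑ i, σ i ^ 2)
    (g' := fun σ p => fieldCLM σ
      - (∑ i, σ i ^ 2) • (deriv κ p.1 • ContinuousLinearMap.fst ℝ ℝ (Fin N → ℝ)))
    (B := fun _ => (N : ℝ) * N + D * N)
    (bound := fun _ => Real.exp (C + (N : ℝ) * N * (‖p‖ + 1) + D * N)) hU ?_ ?_ ?_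
    aestronglyMeasurable_const ?_ (integrable_const _) (integrable_const _) ?_
  · filter_upwards [hP] with σ hσ q hq
    have h0 : 0 ≤ ∑ i, σ i ^ 2 := Finset.sum_nonneg fun i _ => sq_nonneg _
    constructor
    · have h1 := ((fieldCLM σ).hasFDerivAt (x := q)).const_add (G σ)
      simp only [fieldCLM_apply] at h1
      exact h1.sub (((hκ q.1 hq.1).1.hasDerivAt.comp_hasFDerivAt q
        (hasFDerivAt_fst (𝕜 := ℝ) (E := ℝ) (F := Fin N → ℝ))).mul_const (∑ i, σ i ^ 2))
    · refine (norm_sub_le _ _).trans (add_le_add ?_ ?_)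
      · refine ContinuousLinearMap.opNorm_le_bound _ (by positivity) fun v => ?_
        rw [fieldCLM_apply, Real.norm_eq_abs]
        refine (abs_sum_mul_le_s15 hσ v.2).trans ?_
        gcongr
        exact norm_snd_le v
      · rw [norm_smul, norm_smul, Real.norm_of_nonneg h0, mul_comm D]
        refine mul_le_mul hσ ?_ (by positivity) (Nat.cast_nonneg N)
        rw [Real.norm_eq_abs]
        calc |deriv κ q.1| * ‖ContinuousLinearMap.fst ℝ ℝ (Fin N → ℝ)‖ ≤ D * 1 :=
              mul_le_mul (hκ q.1 hq.1).2.2 (ContinuousLinearMap.norm_fst_le ..) (norm_nonneg _) hD0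
          _ = D := mul_one D
  · intro q _
    fun_prop
  · refine (Continuous.aestronglyMeasurable continuous_fieldCLM).sub ?_
    exact Continuous.aestronglyMeasurable (by fun_prop)
  · filter_upwards [hP] with σ hσ q hq
    refine Real.exp_le_exp.2 ((abs_le.1 (abs_hamiltonian_le hG hσ q.2 (κ q.1))).2.trans ?_)
    have h1 : ‖q.2‖ ≤ ‖p‖ + 1 := by
      have h2 : ‖q - p‖ < 1 := mem_ball_iff_norm.1 hq.2
      have h3 := norm_add_le p (q - p)
      rw [add_sub_cancel] at h3
      exact (norm_snd_le q).trans (by linarith)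
    have h2 := (hκ q.1 hq.1).2.1
    gcongr
  · rw [integral_const_mul]

end LogPartition

/-! ### Dependence on a single overlap parameter -/

theorem contDiffAt_update {m : ℕ} (ℓ : ℕ) (s₀ : ℝ) :
    ContDiffAt ℝ 1 (fun s => Function.update q m s ℓ) s₀ := by
  by_cases h : ℓ = m
  · subst h
    simpa only [Function.update_self] using contDiffAt_fun_id
  · simpa [Function.update_of_ne h] using contDiffAt_const

theorem contDiffAt_increment {m ℓ : ℕ} (h : (if ℓ = 0 then 0 else q (ℓ - 1)) < q ℓ) :
    ContDiffAt ℝ 1 (fun s => increment (Function.update q m s) ℓ) (q m) := by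
  unfold increment
  refine ContDiffAt.sqrt ?_ ?_
  · refine (contDiffAt_const.mul (contDiffAt_update ℓ _)).sub (contDiffAt_const.mul ?_)
    split_ifs
    · exact contDiffAt_const
    · exact contDiffAt_update _ _
  · rw [Function.update_eq_self]
    linarith

theorem boundedFDerivNear_fieldCascade [IsProbabilityMeasure P] {C : ℝ}
    (hP : ∀ᵐ σ ∂P, ∑ i, σ i ^ 2 ≤ (N : ℝ)) (hGm : Measurable G) (hG : ∀ σ, |G σ| ≤ C)
    (hζ : ∀ ℓ ≤ k, 0 ≤ ζ ℓ) (hq : ∀ ℓ ≤ k, (if ℓ = 0 then 0 else q (ℓ - 1)) < q ℓ) (m : ℕ) :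
    ∀ j, BoundedFDerivNear (q m)
      (fun p : ℝ × (Fin N → ℝ) => fieldCascade N k ζ (Function.update q m p.1) P G j p.2) := by
  intro j
  induction j with
  | zero =>
    exact boundedFDerivNear_logPartition (κ := fun s => Function.update q m s k) hP hGm hG
      (contDiffAt_update k _)
  | succ j ih =>
    exact BoundedFDerivNear.softMean
      (f := fun s => fieldCascade N k ζ (Function.update q m s) P G j)
      (c := fun s => increment (Function.update q m s) (k - j)) (hζ _ (Nat.sub_le _ _)) ih
      (contDiffAt_increment (hq _ (Nat.sub_le _ _)))

theorem exists_lipschitzWith_fieldCascade (hζ : ∀ ℓ ≤ k, 0 ≤ ζ ℓ)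
    (h : ∃ K, LipschitzWith K (fieldCascade N k ζ q P G 0)) (j : ℕ) :
    ∃ K, LipschitzWith K (fieldCascade N k ζ q P G j) := by
  obtain ⟨K, hK⟩ := h
  refine ⟨K, ?_⟩
  induction j with
  | zero => exact hK
  | succ j ih => exact lipschitzWith_softMean ih (hζ _ (Nat.sub_le _ _)) _

theorem fieldCascade_update_eq {m : ℕ} (s t : ℝ) :
    ∀ j, m + j < k → fieldCascade N k ζ (Function.update q m s) P G j
      = fieldCascade N k ζ (Function.update q m t) P G j
  | 0, h => by
    simp only [fieldCascade, Function.update_of_ne (show k ≠ m by omega)]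
  | j + 1, h => by
    rw [fieldCascade, fieldCascade, fieldCascade_update_eq s t j (by omega)]
    simp only [increment, Function.update_of_ne (show k - j ≠ m by omega),
      Function.update_of_ne (show k - j - 1 ≠ m by omega)]

/-- Lowering the `m`-th overlap inserts one more Gaussian increment at level `m + 1`. -/
theorem fieldCascade_update_eq_softMean [IsProbabilityMeasure P] {C : ℝ}
    (hP : ∀ᵐ σ ∂P, ∑ i, σ i ^ 2 ≤ (N : ℝ)) (hGm : Measurable G) (hG : ∀ σ, |G σ| ≤ C)
    {m n : ℕ} (hζtop : ζ (m + n + 1) = 1) {s t : ℝ} (hst : s ≤ t) (ht : 0 < n → t ≤ q (m + 1))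
    (hL : ∀ j, ∃ K, LipschitzWith K (fieldCascade N (m + n) ζ (Function.update q m t) P G j)) :
    fieldCascade N (m + n) ζ (Function.update q m s) P G n
      = softMean (ζ (m + 1)) √(2 * (t - s))
          (fieldCascade N (m + n) ζ (Function.update q m t) P G n) := by
  cases n with
  | zero =>
    simp only [add_zero] at hζtop
    simp only [fieldCascade, add_zero, Function.update_self, hζtop]
    exact (softMean_one_logPartition hP hGm hG hst).symm
  | succ n =>
    obtain ⟨K, hK⟩ := hL n
    have ht' := ht n.succ_pos
    rw [fieldCascade, fieldCascade, fieldCascade_update_eq s t n (by omega),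
      show m + (n + 1) - n = m + 1 by omega]
    funext x
    rw [softMean_softMean hK]
    congr 1
    simp only [increment, Nat.succ_ne_zero, if_false, Nat.add_sub_cancel, Function.update_self,
      Function.update_of_ne (show m + 1 ≠ m by omega)]
    rw [Real.sq_sqrt (by linarith), Real.sq_sqrt (by linarith)]
    congr 1
    ring

theorem fieldCascade_update_anti [IsProbabilityMeasure P] {C : ℝ}
    (hP : ∀ᵐ σ ∂P, ∑ i, σ i ^ 2 ≤ (N : ℝ)) (hGm : Measurable G) (hG : ∀ σ, |G σ| ≤ C)
    {m n : ℕ} (hζtop : ζ (m + n + 1) = 1) (hζ0 : ∀ ℓ ≤ m + n, 0 ≤ ζ ℓ) (hζ : ζ m < ζ (m + 1))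
    {s t : ℝ} (hst : s ≤ t) (ht : 0 < n → t ≤ q (m + 1))
    (hs : (if m = 0 then 0 else q (m - 1)) ≤ s)
    (hLs : ∀ j, ∃ K, LipschitzWith K (fieldCascade N (m + n) ζ (Function.update q m s) P G j))
    (hLt : ∀ j, ∃ K, LipschitzWith K (fieldCascade N (m + n) ζ (Function.update q m t) P G j))
    {j : ℕ} (hj : n + 1 ≤ j) (hjk : j ≤ m + n + 1) (x : Fin N → ℝ) :
    fieldCascade N (m + n) ζ (Function.update q m t) P G j x
      ≤ fieldCascade N (m + n) ζ (Function.update q m s) P G j x := by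
  induction j, hj using Nat.le_induction generalizing x with
  | base =>
    obtain ⟨K, hK⟩ := hLt n
    have hζm : 0 ≤ ζ m := hζ0 m (by omega)
    rw [fieldCascade, fieldCascade, show m + n - n = m by omega,
      fieldCascade_update_eq_softMean hP hGm hG hζtop hst ht hLt]
    have hinc : increment (Function.update q m t) m
        = √(increment (Function.update q m s) m ^ 2 + √(2 * (t - s)) ^ 2) := by
      have hne : ∀ u, (if m = 0 then 0 else Function.update q m u (m - 1))
          = if m = 0 then 0 else q (m - 1) := fun u => by
        split_ifs with h
        · rfl
        · rw [Function.update_of_ne (by omega)]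
      simp only [increment, hne, Function.update_self]
      rw [Real.sq_sqrt (by linarith), Real.sq_sqrt (by linarith)]
      congr 1
      ring
    rw [hinc, ← softMean_softMean hK]
    exact softMean_mono (lipschitzWith_softMean hK hζm _)
      (lipschitzWith_softMean hK (hζm.trans hζ.le) _) hζm
      (softMean_le_softMean hK hζm hζ _) _ _
  | succ j hj ih =>
    obtain ⟨K, hK⟩ := hLt j
    obtain ⟨K', hK'⟩ := hLs j
    rw [fieldCascade, fieldCascade]
    have hinc : increment (Function.update q m t) (m + n - j)
        = increment (Function.update q m s) (m + n - j) := by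
      simp only [increment, Function.update_of_ne (show m + n - j ≠ m by omega)]
      split_ifs with h
      · rfl
      · rw [Function.update_of_ne (by omega), Function.update_of_ne (by omega)]
    rw [hinc]
    exact softMean_mono hK hK' (hζ0 _ (by omega)) (fun x => ih (by omega) x) _ _

end Cascade

/-- Lemma 2.4 of the paper: for `P` supported in `{|σ|² ≤ N}`, the partial derivative
`∂_{q_m} F` exists at every parameter point `0 < q_0 < ⋯ < q_k` and is nonnegative. -/
theorem freeEnergyQ_deriv_nonneg (N k : ℕ) (hN : 1 ≤ N)
    (ζ : ℕ → ℝ) (hζ0 : ζ 0 = 0) (hζtop : ζ (k + 1) = 1)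
    (hζ : ∀ ℓ ≤ k, ζ ℓ < ζ (ℓ + 1))
    (q : ℕ → ℝ) (hq0 : 0 < q 0) (hq : ∀ ℓ < k, q ℓ < q (ℓ + 1))
    (P : Measure (Fin N → ℝ)) [IsProbabilityMeasure P]
    (hP : P {σ | ∑ i, σ i ^ 2 ≤ N} = 1)
    (G : (Fin N → ℝ) → ℝ) (hGmeas : Measurable G) (hGbdd : ∃ C, ∀ σ, |G σ| ≤ C)
    (m : ℕ) (hm : m ≤ k) :
    ∃ d : ℝ, 0 ≤ d ∧
      HasDerivAt (fun s => freeEnergyQ N k ζ P G (Function.update q m s)) d (q m) := by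
  obtain ⟨n, rfl⟩ := Nat.exists_eq_add_of_le hm
  obtain ⟨C, hC⟩ := hGbdd
  have hP' : ∀ᵐ σ ∂P, ∑ i, σ i ^ 2 ≤ (N : ℝ) :=
    (mem_ae_iff_prob_eq_one (measurableSet_le (by fun_prop) measurable_const)).2 hP
  have hpos : ∀ ℓ, 1 ≤ ℓ → ℓ ≤ m + n + 1 → 0 < ζ ℓ := by
    intro ℓ hℓ
    induction ℓ, hℓ using Nat.le_induction with
    | base => intro _; simpa [hζ0] using hζ 0 (Nat.zero_le _)
    | succ ℓ hℓ ih => intro h; exact (ih (by omega)).trans (hζ ℓ (by omega))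
  have hnonneg : ∀ ℓ ≤ m + n, 0 ≤ ζ ℓ := by
    intro ℓ hℓ
    rcases Nat.eq_zero_or_pos ℓ with rfl | h
    · exact hζ0.ge
    · exact (hpos ℓ h (by omega)).le
  have hq' : ∀ ℓ ≤ m + n, (if ℓ = 0 then 0 else q (ℓ - 1)) < q ℓ := by
    intro ℓ hℓ
    split_ifs with h
    · rwa [h]
    · simpa [Nat.sub_add_cancel (Nat.one_le_iff_ne_zero.2 h)] using hq (ℓ - 1) (by omega)
  have hbd := boundedFDerivNear_fieldCascade (k := m + n) hP' hGmeas hC hnonneg hq' m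
  have hfree : ∀ s, freeEnergyQ N (m + n) ζ P G (Function.update q m s)
      = -(1 / (N : ℝ)) * fieldCascade N (m + n) ζ (Function.update q m s) P G (m + n + 1) 0 :=
    fun s => freeEnergyQ_eq_fieldCascade hζ0 fun ℓ h1 h2 => (hpos ℓ h1 (by omega)).ne'
  obtain ⟨K, hK⟩ := hbd (m + n + 1)
  have hdiff : DifferentiableAt ℝ
      (fun s => freeEnergyQ N (m + n) ζ P G (Function.update q m s)) (q m) := by
    simp only [hfree]
    exact ((hK.self_of_nhds 0).1.comp (q m) (f := fun s : ℝ => (s, (0 : Fin N → ℝ)))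
      (by fun_prop)).const_mul _
  refine ⟨_, ?_, hdiff.hasDerivAt⟩
  set S : Set ℝ := {s | (∃ K, LipschitzWith K
    (fieldCascade N (m + n) ζ (Function.update q m s) P G 0))
      ∧ (0 < n → s ≤ q (m + 1)) ∧ (if m = 0 then 0 else q (m - 1)) ≤ s}
  have hmem : S ∈ nhds (q m) := by
    refine Filter.Eventually.and (hbd 0).eventually_lipschitzWith (Filter.Eventually.and ?_ ?_)
    · refine Filter.eventually_imp_distrib_left.2 fun hn => ?_
      exact (eventually_lt_nhds (hq m (by omega))).mono fun _ h => h.le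
    · exact (eventually_gt_nhds (hq' m (by omega))).mono fun _ h => h.le
  have hmono : MonotoneOn (fun s => freeEnergyQ N (m + n) ζ P G (Function.update q m s)) S := by
    intro s hs t ht hst
    simp only [hfree]
    refine mul_le_mul_of_nonpos_left ?_ (neg_nonpos.2 (by positivity))
    exact fieldCascade_update_anti hP' hGmeas hC hζtop hnonneg (hζ m (by omega)) hst ht.2.1 hs.2.2
      (exists_lipschitzWith_fieldCascade hnonneg hs.1)
      (exists_lipschitzWith_fieldCascade hnonneg ht.1) (by omega) le_rfl 0
  rw [← derivWithin_of_mem_nhds hmem]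
  exact hmono.derivWithin_nonneg
end
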